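/- For every integer n ≥ 3 there exist a Ważewski dendrite X of order n and a finitely generated subgroup G of Homeo(X), dense in Homeo(X), such that neither G nor its commutator subgroup [G,G] is invariably generated; equivalently, G has a proper subgroup H with G = ⋃_{g∈G} gHg⁻¹, and [G,G] has a proper subgroup H' with [G,G] = ⋃_{h∈[G,G]} hH'h⁻¹. -/

import Mathlib

open Topology

/-- The set of connected components of a subset `S` of `X`. -/
def setComponents (X : Type*) [TopologicalSpace X] (S : Set X) : Set (Set X) :=
  {C | ∃ x ∈ S, C = connectedComponentIn S x}

/-- The order of a point `p` of `X`: the number of connected components of `X \ {p}`. -/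
noncomputable def ptOrder (X : Type*) [TopologicalSpace X] (p : X) : ℕ :=
  (setComponents X {p}ᶜ).ncard

/-- A dendrite: a nonempty, compact, connected, locally connected metrizable space
containing no subspace homeomorphic to the circle. -/
def IsDendrite (X : Type*) [TopologicalSpace X] : Prop :=
  Nonempty X ∧ CompactSpace X ∧ ConnectedSpace X ∧ LocallyConnectedSpace X ∧
    TopologicalSpace.MetrizableSpace X ∧
    ∀ S : Set X, IsEmpty (S ≃ₜ Circle)

/-- A Ważewski dendrite of order `n`: a dendrite all of whose points have order `1`, `2`
or `n`, and every arc (subspace homeomorphic to `[0,1]`) contains a point of order `n`. -/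
def IsWazewskiDendrite (n : ℕ) (X : Type*) [TopologicalSpace X] : Prop :=
  IsDendrite X ∧
  (∀ p : X, ptOrder X p = 1 ∨ ptOrder X p = 2 ∨ ptOrder X p = n) ∧
  ∀ A : Set X, Nonempty (A ≃ₜ unitInterval) → ∃ p ∈ A, ptOrder X p = n

/-- The group structure on self-homeomorphisms of `X`, with composition as product. -/
instance Homeomorph.instGroupSelf (X : Type*) [TopologicalSpace X] : Group (X ≃ₜ X) where
  mul f g := g.trans f
  one := Homeomorph.refl X
  inv := Homeomorph.symm
  mul_assoc _ _ _ := rfl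
  one_mul _ := Homeomorph.ext fun _ => rfl
  mul_one _ := Homeomorph.ext fun _ => rfl
  inv_mul_cancel := Homeomorph.self_trans_symm

/-- The compact-open topology on the group of self-homeomorphisms of `X` (for compact
metric `X`, this is the topology of uniform convergence). -/
instance Homeomorph.instTopSelf (X : Type*) [TopologicalSpace X] :
    TopologicalSpace (X ≃ₜ X) :=
  TopologicalSpace.induced (fun h : X ≃ₜ X => (h : C(X, X))) ContinuousMap.compactOpen


/-- Combinatorial structure of the set of branch points: `dir p q` is the direction
at `p` pointing to `q`. -/
structure DTree (B Δ : Type) where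
  dir : B → B → Δ
  tri : ∀ p q r, q ≠ r → p ≠ q → p ≠ r → dir q p = dir q r ∨ dir r p = dir r q
  dense : ∀ p q, p ≠ q → ∃ r, r ≠ p ∧ r ≠ q ∧ dir r p ≠ dir r q
  surj : ∀ p d, ∃ q, q ≠ p ∧ dir p q = d
  med : ∀ p q r, ∃ m, (m = p ∨ m = q ∨ dir m p ≠ dir m q) ∧ (m = q ∨ m = r ∨ dir m q ≠ dir m r) ∧
    (m = p ∨ m = r ∨ dir m p ≠ dir m r)

namespace DTree

variable {B Δ : Type} (T : DTree B Δ)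

/-- The dendrite associated with the structure. -/
def X : Type := {s : B → Option Δ //
  (∀ p q, p ≠ q → s p = some (T.dir p q) ∨ s q = some (T.dir q p)) ∧
  ∀ p, (∀ q, q ≠ p → s q = some (T.dir q p)) → s p = none}

variable {T}

theorem X.ext' {x y : T.X} (h : ∀ p, x.1 p = y.1 p) : x = y := Subtype.ext (funext h)

variable (T)

/-- Open half-space. -/
def hs (p : B) (d : Δ) : Set T.X := {x | x.1 p = some d}

theorem mem_hs {p : B} {d : Δ} {x : T.X} : x ∈ T.hs p d ↔ x.1 p = some d := Iff.rfl

instance : TopologicalSpace T.X :=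
  TopologicalSpace.generateFrom (Set.range fun a : B × Δ => T.hs a.1 a.2)

theorem isOpen_hs (p : B) (d : Δ) : IsOpen (T.hs p d) :=
  TopologicalSpace.isOpen_generateFrom_of_mem ⟨(p, d), rfl⟩

open Classical in
/-- The branch point. -/
noncomputable def br (p : B) : T.X := ⟨fun q => if q = p then none else some (T.dir q p), by
  refine ⟨fun q r hqr => ?_, fun q hq => ?_⟩
  · by_cases h1 : q = p
    · subst h1
      right; simp [hqr.symm]
    · by_cases h2 : r = p
      · subst h2; left; simp [h1]
      · simp only [h1, h2, if_false, Option.some.injEq]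
        exact T.tri p q r hqr (Ne.symm h1) (Ne.symm h2)
  · by_cases h1 : q = p
    · simp [h1]
    · have := hq p (Ne.symm h1)
      simp at this⟩

theorem br_self (p : B) : (T.br p).1 p = none := by simp [br]

theorem br_ne {p q : B} (h : q ≠ p) : (T.br p).1 q = some (T.dir q p) := by simp [br, h]

theorem eq_br_iff (x : T.X) (p : B) : x = T.br p ↔ x.1 p = none := by
  constructor
  · rintro rfl; exact T.br_self p
  · intro h
    apply X.ext'
    intro q
    by_cases hq : q = p
    · subst hq; rw [h, br_self]
    · rw [br_ne _ hq]
      rcases x.2.1 p q (Ne.symm hq) with h1 | h1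
      · rw [h] at h1; exact absurd h1 (by simp)
      · exact h1

theorem br_inj {p q : B} (h : T.br p = T.br q) : p = q := by
  by_contra hpq
  have h1 := T.br_self p
  rw [h, br_ne _ hpq] at h1
  simp at h1

theorem exists_dir {x : T.X} {p : B} (h : x ≠ T.br p) : ∃ d, x.1 p = some d := by
  rw [Ne, eq_br_iff] at h
  exact Option.ne_none_iff_exists'.1 h

theorem cons {x : T.X} {p q : B} (hpq : p ≠ q) (h : x.1 p ≠ some (T.dir p q)) :
    x.1 q = some (T.dir q p) := (x.2.1 p q hpq).resolve_left h

/-- Separation of points by branch points. -/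
theorem sep {x y : T.X} (h : x ≠ y) : ∃ p, x.1 p ≠ y.1 p ∧ x.1 p ≠ none ∧ y.1 p ≠ none := by
  have key : ∀ (p : B) (y : T.X), y ≠ T.br p →
      ∃ q, (T.br p).1 q ≠ y.1 q ∧ (T.br p).1 q ≠ none ∧ y.1 q ≠ none := by
    intro p y hy
    have h1 : ∃ q, q ≠ p ∧ y.1 q ≠ some (T.dir q p) := by
      by_contra hcon
      push Not at hcon
      exact hy ((T.eq_br_iff y p).2 (y.2.2 p hcon))
    obtain ⟨q, hq, hq2⟩ := h1
    by_cases h2 : y.1 q = none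
    · rw [← eq_br_iff] at h2
      subst h2
      obtain ⟨r, hr1, hr2, hr3⟩ := T.dense p q (Ne.symm hq)
      exact ⟨r, by rw [br_ne _ hr1, br_ne _ hr2]; simpa using hr3, by simp [br_ne _ hr1],
        by simp [br_ne _ hr2]⟩
    · exact ⟨q, by rw [br_ne _ hq]; exact Ne.symm hq2, by simp [br_ne _ hq], h2⟩
  have h1 : ∃ p, x.1 p ≠ y.1 p := by
    by_contra hcon
    push Not at hcon
    exact h (X.ext' hcon)
  obtain ⟨p, hp⟩ := h1
  by_cases hx : x.1 p = none
  · rw [← eq_br_iff] at hx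
    subst hx
    exact key p y (Ne.symm h)
  · by_cases hy : y.1 p = none
    · rw [← eq_br_iff] at hy
      subst hy
      obtain ⟨q, h1, h2, h3⟩ := key p x h
      exact ⟨q, Ne.symm h1, h3, h2⟩
    · exact ⟨p, hp, hx, hy⟩

/-- A branch point strictly between `p` and `x`. -/
theorem exists_between {x : T.X} {p : B} {d : Δ} (h : x.1 p = some d) :
    ∃ q e, q ≠ p ∧ x.1 q = some e ∧ e ≠ T.dir q p ∧ T.dir p q = d := by
  have hx : x ≠ T.br p := by rw [Ne, eq_br_iff, h]; simp
  obtain ⟨q, h1, h2, h3⟩ := T.sep hx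
  have hqp : q ≠ p := by
    rintro rfl
    exact h3 (T.br_self q)
  obtain ⟨e, he⟩ := Option.ne_none_iff_exists'.1 h2
  rw [br_ne _ hqp, he] at h1
  have h1' : e ≠ T.dir q p := by simpa using h1
  refine ⟨q, e, hqp, he, h1', ?_⟩
  have := T.cons hqp (x := x) (by rw [he]; simpa using h1')
  rw [h] at this
  simpa using this.symm

instance : T2Space T.X := ⟨fun x y h => by
  obtain ⟨p, h1, h2, h3⟩ := T.sep h
  obtain ⟨d, hd⟩ := Option.ne_none_iff_exists'.1 h2
  obtain ⟨e, he⟩ := Option.ne_none_iff_exists'.1 h3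
  refine ⟨T.hs p d, T.hs p e, T.isOpen_hs _ _, T.isOpen_hs _ _, hd, he, ?_⟩
  rw [Set.disjoint_left]
  intro z hz hz'
  simp only [hs, Set.mem_ofPred_eq] at hz hz'
  apply h1
  rw [hd, he, ← hz, ← hz']⟩

instance [Countable B] [Finite Δ] : SecondCountableTopology T.X :=
  ⟨⟨_, Set.countable_range _, rfl⟩⟩

/-! Compactness and connectedness. -/

/-- Consistent orientations. -/
def RR : Set (B → Δ) := {f | ∀ p q, p ≠ q → f p = T.dir p q ∨ f q = T.dir q p}

open Classical in
/-- Collapsing map. -/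
noncomputable def col (f : T.RR) : T.X :=
  ⟨fun p => if (∀ q, q ≠ p → f.1 q = T.dir q p) then none else some (f.1 p), by
    constructor
    · intro p q hpq
      by_cases hp : ∀ r, r ≠ p → f.1 r = T.dir r p
      · by_cases hq : ∀ r, r ≠ q → f.1 r = T.dir r q
        · exfalso
          obtain ⟨r, hr1, hr2, hr3⟩ := T.dense p q hpq
          exact hr3 ((hp r hr1).symm.trans (hq r hr2))
        · right
          beta_reduce
          rw [if_neg hq, hp q (Ne.symm hpq)]
      · by_cases hq : ∀ r, r ≠ q → f.1 r = T.dir r q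
        · left
          beta_reduce
          rw [if_neg hp, hq p hpq]
        · beta_reduce
          rw [if_neg hp, if_neg hq]
          rcases f.2 p q hpq with h | h
          · left; rw [h]
          · right; rw [h]
    · intro p hp
      beta_reduce
      rw [if_pos]
      intro q hq
      have := hp q hq
      beta_reduce at this
      by_cases h2 : ∀ r, r ≠ q → f.1 r = T.dir r q
      · rw [if_pos h2] at this; simp at this
      · rw [if_neg h2] at this; simpa using this⟩

open Classical in
theorem col_val (f : T.RR) (p : B) : (T.col f).1 p =
    if (∀ q, q ≠ p → f.1 q = T.dir q p) then none else some (f.1 p) := rfl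

/-- The spurious orientation converging to `p` with direction `d` at `p`. -/
theorem spur_mem [DecidableEq B] (p : B) (d : Δ) :
    (fun q => if q = p then d else T.dir q p) ∈ T.RR := by
  intro q r hqr
  by_cases h1 : q = p
  · subst h1; right; simp [hqr.symm]
  · by_cases h2 : r = p
    · subst h2; left; simp [h1]
    · simp only [h1, h2, if_false]
      exact T.tri p q r hqr (Ne.symm h1) (Ne.symm h2)

open Classical in
/-- The spurious orientation. -/
noncomputable def spur (p : B) (d : Δ) : T.RR := ⟨_, T.spur_mem p d⟩

theorem spur_ne {p q : B} (d : Δ) (h : q ≠ p) : (T.spur p d).1 q = T.dir q p := by simp [spur, h]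
theorem spur_self (p : B) (d : Δ) : (T.spur p d).1 p = d := by simp [spur]

theorem col_spur (p : B) (d : Δ) : T.col (T.spur p d) = T.br p := by
  rw [eq_br_iff]
  simp only [col]
  rw [if_pos]
  intro q hq
  exact T.spur_ne d hq

theorem col_surj [Nonempty Δ] : Function.Surjective T.col := by
  intro x
  by_cases h : ∃ p, x.1 p = none
  · obtain ⟨p, hp⟩ := h
    exact ⟨T.spur p (Classical.arbitrary _), by rw [col_spur, ((T.eq_br_iff x p).2 hp)]⟩
  · push Not at h
    have h' := fun p => Option.ne_none_iff_exists'.1 (h p)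
    choose f hf using h'
    refine ⟨⟨f, ?_⟩, ?_⟩
    · intro p q hpq
      have := x.2.1 p q hpq
      simpa [hf] using this
    · apply X.ext'
      intro p
      simp only [col]
      rw [if_neg, hf]
      intro hcon
      apply h p
      apply x.2.2
      intro q hq
      rw [hf, hcon q hq]

theorem continuous_col [TopologicalSpace Δ] [DiscreteTopology Δ] : Continuous T.col := by
  apply continuous_generateFrom_iff.2
  rintro _ ⟨⟨p, d⟩, rfl⟩
  have : T.col ⁻¹' (T.hs p d) = {f : T.RR | f.1 p = d} ∩ ⋃ q : {q // q ≠ p}, {f : T.RR | f.1 q ≠ T.dir q p} := by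
    ext f
    simp only [Set.mem_preimage, mem_hs, Set.mem_ofPred_eq, Set.mem_inter_iff, Set.mem_iUnion]
    rw [col_val]
    by_cases h : ∀ q, q ≠ p → f.1 q = T.dir q p
    · rw [if_pos h]
      simp only [reduceCtorEq, false_iff, not_and, not_exists, not_not]
      rintro - ⟨q, hq⟩
      exact h q hq
    · rw [if_neg h]
      push Not at h
      obtain ⟨q, hq, hq2⟩ := h
      simp only [Option.some.injEq]
      exact ⟨fun h => ⟨h, ⟨q, hq⟩, hq2⟩, fun h => h.1⟩
  have hc : ∀ q : B, Continuous fun f : T.RR => f.1 q := fun q =>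
    (continuous_apply q).comp continuous_subtype_val
  rw [this]
  refine IsOpen.inter ((isOpen_discrete {d}).preimage (hc p)) (isOpen_iUnion fun q => ?_)
  exact (isOpen_discrete {T.dir q p}ᶜ).preimage (hc q)

theorem isCompact_RR [TopologicalSpace Δ] [DiscreteTopology Δ] [Finite Δ] : IsCompact T.RR := by
  apply IsClosed.isCompact
  have : T.RR = ⋂ p, ⋂ q, ⋂ (_ : p ≠ q), ({f | f p = T.dir p q} ∪ {f | f q = T.dir q p}) := by
    ext f; simp [RR]
  rw [this]
  refine isClosed_iInter fun p => isClosed_iInter fun q => isClosed_iInter fun _ => IsClosed.union ?_ ?_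
  · exact isClosed_eq (continuous_apply p) continuous_const
  · exact isClosed_eq (continuous_apply q) continuous_const

instance instCompact [Finite Δ] [Nonempty Δ] : CompactSpace T.X := by
  let _ : TopologicalSpace Δ := ⊥
  have : DiscreteTopology Δ := ⟨rfl⟩
  have := isCompact_iff_compactSpace.1 T.isCompact_RR
  exact T.col_surj.compactSpace T.continuous_col

theorem leaf (E : Finset B) (hE : E.Nonempty) : ∃ p ∈ E, ∃ d, ∀ q ∈ E, q ≠ p → T.dir p q = d := by
  classical
  obtain ⟨e, he⟩ := hE
  by_cases h1 : (E.erase e).Nonempty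
  · obtain ⟨p, hp, hmax⟩ := Finset.exists_max_image (E.erase e)
      (fun p => (E.filter fun q => q ≠ p ∧ T.dir p q = T.dir p e).card) h1
    have hpe : p ≠ e := Finset.ne_of_mem_erase hp
    refine ⟨p, Finset.mem_of_mem_erase hp, T.dir p e, fun q hq hqp => ?_⟩
    by_contra hne
    have hqe : q ≠ e := by rintro rfl; exact hne rfl
    have := hmax q (Finset.mem_erase.2 ⟨hqe, hq⟩)
    refine absurd this (not_le.2 (Finset.card_lt_card ?_))
    have hq_pe : T.dir q p = T.dir q e := by
      rcases T.tri e p q (Ne.symm hqp) (Ne.symm hpe) (Ne.symm hqe) with h | h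
      · exact absurd h.symm hne
      · exact h.symm
    refine Finset.ssubset_iff_subset_ne.2 ⟨?_, ?_⟩
    · intro r hr
      rw [Finset.mem_filter] at hr ⊢
      obtain ⟨hr1, hr2, hr3⟩ := hr
      have hrq : r ≠ q := by rintro rfl; exact hne hr3
      refine ⟨hr1, hrq, ?_⟩
      rcases T.tri r p q (Ne.symm hqp) hr2 hrq with h | h
      · exact absurd (h.symm.trans hr3) hne
      · rw [h, hq_pe]
    · intro heq
      have hmem : p ∈ E.filter fun r => r ≠ q ∧ T.dir q r = T.dir q e :=
        Finset.mem_filter.2 ⟨Finset.mem_of_mem_erase hp, Ne.symm hqp, hq_pe⟩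
      rw [← heq, Finset.mem_filter] at hmem
      exact hmem.2.1 rfl
  · rw [Finset.not_nonempty_iff_eq_empty] at h1
    refine ⟨e, he, T.dir e e, fun q hq hqe => ?_⟩
    have : q ∈ E.erase e := Finset.mem_erase.2 ⟨hqe, hq⟩
    rw [h1] at this
    simp at this

theorem const_of_dep (f : T.RR → Bool) (hf : ∀ p d e, f (T.spur p d) = f (T.spur p e)) (E : Finset B) :
    (∀ a b : T.RR, (∀ p ∈ E, a.1 p = b.1 p) → f a = f b) → ∀ a b, f a = f b := by
  classical
  induction hn : E.card generalizing E with
  | zero =>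
    intro h a b
    rw [Finset.card_eq_zero] at hn
    subst hn
    exact h a b (by simp)
  | succ k ih =>
    intro h
    obtain ⟨p, hp, d, hd⟩ := T.leaf E (Finset.card_pos.1 (by omega))
    refine ih (E.erase p) (by rw [Finset.card_erase_of_mem hp]; omega) ?_
    have key : ∀ a b : T.RR, (∀ q ∈ E.erase p, a.1 q = b.1 q) → a.1 p ≠ d → f b = f (T.spur p d) := by
      intro a b hab hap
      have hq : ∀ q ∈ E.erase p, b.1 q = T.dir q p := by
        intro q hq
        have hqp := Finset.ne_of_mem_erase hq
        rw [← hab q hq]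
        rcases a.2 q p hqp with h1 | h1
        · exact h1
        · exact absurd (h1.trans (hd q (Finset.mem_of_mem_erase hq) hqp)) hap
      rw [hf p d (b.1 p)]
      apply h
      intro q hqE
      by_cases hqp : q = p
      · subst hqp; rw [spur_self]
      · rw [spur_ne _ _ hqp]
        exact hq q (Finset.mem_erase.2 ⟨hqp, hqE⟩)
    intro a b hab
    by_cases ha : a.1 p = d
    · by_cases hb : b.1 p = d
      · apply h
        intro q hq
        by_cases hqp : q = p
        · subst hqp; rw [ha, hb]
        · exact hab q (Finset.mem_erase.2 ⟨hqp, hq⟩)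
      · rw [key b a (fun q hq => (hab q hq).symm) hb, key b b (fun _ _ => rfl) hb]
    · rw [key a b hab ha, key a a (fun _ _ => rfl) ha]

instance instPreconn [Finite Δ] [Nonempty Δ] : PreconnectedSpace T.X := by
  let _ : TopologicalSpace Δ := ⊥
  have : DiscreteTopology Δ := ⟨rfl⟩
  have := isCompact_iff_compactSpace.1 T.isCompact_RR
  apply preconnectedSpace_of_forall_constant
  intro f hf x y
  obtain ⟨a, rfl⟩ := T.col_surj x
  obtain ⟨b, rfl⟩ := T.col_surj y
  have hg : Continuous (f ∘ T.col) := hf.comp T.continuous_col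
  have hloc : ∀ a : T.RR, ∃ E : Finset B, ∀ b : T.RR, (∀ p ∈ E, b.1 p = a.1 p) →
      f (T.col b) = f (T.col a) := by
    intro a
    have hU : IsOpen ((f ∘ T.col) ⁻¹' {f (T.col a)}) := (isOpen_discrete _).preimage hg
    obtain ⟨V, hV, hVU⟩ := isOpen_induced_iff.1 hU
    have haV : a.1 ∈ V := by
      have : a ∈ Subtype.val ⁻¹' V := by rw [hVU]; rfl
      exact this
    obtain ⟨I, u, hu, huV⟩ := isOpen_pi_iff.1 hV a.1 haV
    refine ⟨I, fun b hb => ?_⟩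
    have : b ∈ Subtype.val ⁻¹' V := huV (by
      intro p hp
      rw [hb p hp]
      exact (hu p hp).2)
    rw [hVU] at this
    exact this
  choose E hE using hloc
  have hnb : ∀ a : T.RR, {b : T.RR | ∀ p ∈ E a, b.1 p = a.1 p} ∈ nhds a := by
    intro a
    have : {b : T.RR | ∀ p ∈ E a, b.1 p = a.1 p} = ⋂ p ∈ E a, {b : T.RR | b.1 p = a.1 p} := by
      ext b; simp
    rw [this]
    refine (Filter.biInter_finset_mem _).2 fun p _ => ?_
    have hc : Continuous fun b : T.RR => b.1 p := (continuous_apply p).comp continuous_subtype_val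
    exact hc.continuousAt.eventually_mem ((isOpen_discrete {a.1 p}).mem_nhds rfl)
  obtain ⟨t, -, ht⟩ := isCompact_univ.elim_nhds_subcover _ (fun a _ => hnb a)
  classical
  refine T.const_of_dep (f ∘ T.col) (fun p d e => ?_) (t.biUnion E) (fun a b hab => ?_) a b
  · simp only [Function.comp, col_spur]
  · obtain ⟨c, hc, hac⟩ := Set.mem_iUnion₂.1 (ht (Set.mem_univ a))
    have h1 := hE c a hac
    have h2 := hE c b (fun p hp => by rw [← hab p (Finset.mem_biUnion.2 ⟨c, hc, hp⟩)]; exact hac p hp)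
    exact h1.trans h2.symm

end DTree

namespace DTree

variable {B Δ : Type} (T : DTree B Δ)

/-- Closed cone at `q`. -/
def Cs (q : B) (S : Set Δ) : Set T.X := {x | x.1 q = none ∨ ∃ d ∈ S, x.1 q = some d}

theorem mem_Cs {q : B} {S : Set Δ} {x : T.X} :
    x ∈ T.Cs q S ↔ (x.1 q = none ∨ ∃ d ∈ S, x.1 q = some d) := Iff.rfl

open Classical in
/-- Retraction onto a cone. -/
noncomputable def ret (q : B) (S : Set Δ) (x : T.X) : T.X := if x ∈ T.Cs q S then x else T.br q

theorem br_mem_Cs (q : B) (S : Set Δ) : T.br q ∈ T.Cs q S := Or.inl (T.br_self q)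

theorem Cs_ne {q : B} {S : Set Δ} {x : T.X} {d : Δ} (hx : x ∈ T.Cs q S) (hd : d ∉ S) :
    x.1 q ≠ some d := by
  rcases hx with h | ⟨e, he, h⟩
  · rw [h]; simp
  · rw [h]; rintro ⟨⟩; exact hd he

theorem not_Cs {q : B} {S : Set Δ} {x : T.X} (hx : x ∉ T.Cs q S) :
    ∃ e, e ∉ S ∧ x.1 q = some e := by
  rw [mem_Cs] at hx
  push Not at hx
  obtain ⟨e, he⟩ := Option.ne_none_iff_exists'.1 hx.1
  exact ⟨e, fun h => hx.2 e h he, he⟩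

theorem continuous_ret (q : B) (S : Set Δ) : Continuous (T.ret q S) := by
  apply continuous_generateFrom_iff.2
  rintro _ ⟨⟨p, d⟩, rfl⟩
  have hor : T.ret q S ⁻¹' T.hs p d = T.hs p d ∨ T.ret q S ⁻¹' T.hs p d = ∅ ∨
      T.ret q S ⁻¹' T.hs p d = Set.univ := by
    by_cases hpq : p = q
    · subst hpq
      by_cases hd : d ∈ S
      · left
        ext x
        rw [Set.mem_preimage, ret]
        split_ifs with h
        · rfl
        · obtain ⟨e, he, hx⟩ := T.not_Cs h
          rw [mem_hs, mem_hs, br_self, hx]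
          simp only [reduceCtorEq, Option.some.injEq, false_iff]
          rintro rfl; exact he hd
      · right; left
        rw [Set.eq_empty_iff_forall_notMem]
        intro x
        rw [Set.mem_preimage, ret]
        split_ifs with h
        · exact T.Cs_ne h hd
        · rw [mem_hs, br_self]; simp
    · by_cases hd : T.dir p q = d
      · by_cases hS : T.dir q p ∈ S
        · left
          ext x
          rw [Set.mem_preimage, ret]
          split_ifs with h
          · rfl
          · obtain ⟨e, he, hx⟩ := T.not_Cs h
            rw [mem_hs, mem_hs, br_ne _ hpq, hd, ← hd]
            refine ⟨fun _ => ?_, fun _ => rfl⟩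
            apply T.cons (Ne.symm hpq)
            rw [hx]; rintro ⟨⟩; exact he hS
        · right; right
          rw [Set.eq_univ_iff_forall]
          intro x
          rw [Set.mem_preimage, ret]
          split_ifs with h
          · rw [mem_hs, ← hd]
            exact T.cons (Ne.symm hpq) (T.Cs_ne h hS)
          · rw [mem_hs, br_ne _ hpq, hd]
      · have key : ∀ x : T.X, x.1 p = some d → x.1 q = some (T.dir q p) := by
          intro x hx
          apply T.cons hpq
          rw [hx]; rintro ⟨⟩; exact hd rfl
        by_cases hS : T.dir q p ∈ S
        · left
          ext x
          rw [Set.mem_preimage, ret]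
          split_ifs with h
          · rfl
          · rw [mem_hs, mem_hs, br_ne _ hpq]
            constructor
            · rintro ⟨⟩; exact absurd rfl hd
            · intro hx; exact absurd (Or.inr ⟨_, hS, key x hx⟩) h
        · right; left
          rw [Set.eq_empty_iff_forall_notMem]
          intro x
          rw [Set.mem_preimage, ret]
          split_ifs with h
          · intro hx; exact T.Cs_ne h hS (key x hx)
          · rw [mem_hs, br_ne _ hpq]; rintro ⟨⟩; exact absurd rfl hd
  rcases hor with h | h | h
  · exact h ▸ T.isOpen_hs p d
  · exact h ▸ isOpen_empty
  · exact h ▸ isOpen_univ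

theorem conn_dir {K : Set T.X} (hK : IsPreconnected K) {q : B} (hq : T.br q ∉ K) {x y : T.X}
    (hx : x ∈ K) (hy : y ∈ K) : x.1 q = y.1 q := by
  obtain ⟨d, hd⟩ := T.exists_dir (x := x) (p := q) (by rintro rfl; exact hq hx)
  have hsub : K ⊆ T.hs q d := by
    refine IsPreconnected.subset_left_of_subset_union (T.isOpen_hs q d)
      (v := ⋃ e : {e // e ≠ d}, T.hs q e) (isOpen_iUnion fun e => T.isOpen_hs q e) ?_ ?_ ⟨x, hx, hd⟩ hK
    · rw [Set.disjoint_left]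
      intro z hz hz'
      obtain ⟨⟨e, he⟩, hz'⟩ := Set.mem_iUnion.1 hz'
      rw [mem_hs] at hz hz'
      rw [hz] at hz'
      exact he (Option.some.inj hz').symm
    · intro z hz
      obtain ⟨e, he⟩ := T.exists_dir (x := z) (p := q) (by rintro rfl; exact hq hz)
      by_cases h : e = d
      · left; rw [mem_hs, he, h]
      · right; exact Set.mem_iUnion.2 ⟨⟨e, h⟩, he⟩
  rw [hd]; exact (hsub hy).symm

theorem inter_Cs {K : Set T.X} (hK : IsPreconnected K) (q : B) (S : Set Δ) :
    IsPreconnected (K ∩ T.Cs q S) := by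
  by_cases hq : T.br q ∈ K
  · have : K ∩ T.Cs q S = T.ret q S '' K := by
      ext x
      constructor
      · rintro ⟨h1, h2⟩
        exact ⟨x, h1, by rw [ret, if_pos h2]⟩
      · rintro ⟨y, hy, rfl⟩
        rw [ret]
        split_ifs with h
        · exact ⟨hy, h⟩
        · exact ⟨hq, T.br_mem_Cs q S⟩
    rw [this]
    exact hK.image _ (T.continuous_ret q S).continuousOn
  · by_cases hne : (K ∩ T.Cs q S).Nonempty
    · obtain ⟨x, hx, hx2⟩ := hne
      have : K ∩ T.Cs q S = K := by
        apply Set.inter_eq_left.2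
        intro y hy
        rw [mem_Cs] at hx2 ⊢
        rwa [← T.conn_dir hK hq hx hy]
      rwa [this]
    · rw [Set.not_nonempty_iff_eq_empty.1 hne]
      exact isPreconnected_empty

theorem Cs_sub_hs {p q : B} (h : q ≠ p) {S : Set Δ} (hS : T.dir q p ∉ S) :
    T.Cs q S ⊆ T.hs p (T.dir p q) := fun _ hy => T.cons h (T.Cs_ne hy hS)

theorem exists_good (U : Set T.X) (hU : IsOpen U) (x : T.X) (hx : x ∈ U) :
    ∃ V ⊆ U, V ∈ nhds x ∧ ∀ K, IsPreconnected K → IsPreconnected (K ∩ V) := by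
  have hU' : TopologicalSpace.GenerateOpen (Set.range fun a : B × Δ => T.hs a.1 a.2) U := hU
  clear hU
  induction hU' with
  | basic s hs =>
    obtain ⟨⟨p, d⟩, rfl⟩ := hs
    obtain ⟨q, e, h1, h2, h3, h4⟩ := T.exists_between hx
    refine ⟨T.Cs q {e}, ?_, ?_, fun K hK => T.inter_Cs hK q {e}⟩
    · have := T.Cs_sub_hs h1 (S := {e}) (by simpa using h3.symm)
      rwa [h4] at this
    · exact Filter.mem_of_superset ((T.isOpen_hs q e).mem_nhds h2) (fun y hy => Or.inr ⟨e, rfl, hy⟩)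
  | univ => exact ⟨Set.univ, subset_rfl, Filter.univ_mem, fun K hK => by rwa [Set.inter_univ]⟩
  | inter s t hs ht ihs iht =>
    obtain ⟨V, h1, h2, h3⟩ := ihs hx.1
    obtain ⟨W, h4, h5, h6⟩ := iht hx.2
    refine ⟨V ∩ W, Set.inter_subset_inter h1 h4, Filter.inter_mem h2 h5, fun K hK => ?_⟩
    rw [← Set.inter_assoc]
    exact h6 _ (h3 _ hK)
  | sUnion S hS ih =>
    obtain ⟨s, hs, hxs⟩ := hx
    obtain ⟨V, h1, h2, h3⟩ := ih s hs hxs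
    exact ⟨V, h1.trans (Set.subset_sUnion_of_mem hs), h2, h3⟩

instance [Finite Δ] [Nonempty Δ] : LocallyConnectedSpace T.X := by
  refine locallyConnectedSpace_of_connected_bases (fun _ V => V)
    (fun x V => V ∈ nhds x ∧ IsPreconnected V) (fun x => ?_) (fun x V h => h.2)
  constructor
  intro t
  constructor
  · intro ht
    obtain ⟨U, hUt, hU, hxU⟩ := mem_nhds_iff.1 ht
    obtain ⟨V, h1, h2, h3⟩ := T.exists_good U hU x hxU
    refine ⟨V, ⟨h2, ?_⟩, h1.trans hUt⟩
    have := h3 _ isPreconnected_univ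
    rwa [Set.univ_inter] at this
  · rintro ⟨V, ⟨h1, h2⟩, h3⟩
    exact Filter.mem_of_superset h1 h3

theorem isPreconnected_Cs [Finite Δ] [Nonempty Δ] (q : B) (S : Set Δ) :
    IsPreconnected (T.Cs q S) := by
  have := T.inter_Cs isPreconnected_univ q S
  rwa [Set.univ_inter] at this

theorem sepd {m p q : B} (h1 : m ≠ q) (h2 : m ≠ p) (h3 : T.dir m p ≠ T.dir m q) :
    T.dir q p = T.dir q m :=
  (T.tri p m q h1 (Ne.symm h2) (by rintro rfl; exact h3 rfl)).resolve_left h3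

theorem isPreconnected_hs [Finite Δ] [Nonempty Δ] (p : B) (d : Δ) : IsPreconnected (T.hs p d) := by
  apply isPreconnected_of_forall_pair
  intro x hx y hy
  obtain ⟨q, e, h1, h2, h3, h4⟩ := T.exists_between hx
  obtain ⟨q', e', h1', h2', h3', h4'⟩ := T.exists_between hy
  obtain ⟨m, hm1, hm2, hm3⟩ := T.med p q q'
  have hmp : m ≠ p := by
    rintro rfl
    rcases hm2 with h | h | h
    · exact h1 h.symm
    · exact h1' h.symm
    · exact h (h4.trans h4'.symm)
  have key : ∀ (x : T.X) (q : B) (e : Δ), q ≠ p → x.1 q = some e → e ≠ T.dir q p →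
      (m = p ∨ m = q ∨ T.dir m p ≠ T.dir m q) → x ∈ T.Cs m {f | f ≠ T.dir m p} := by
    intro x q e h1 h2 h3 h
    by_cases hmq : m = q
    · subst hmq; exact Or.inr ⟨e, h3, h2⟩
    · have h := (h.resolve_left hmp).resolve_left hmq
      refine Or.inr ⟨T.dir m q, Ne.symm h, ?_⟩
      apply T.cons (Ne.symm hmq)
      rw [h2, ← T.sepd hmq hmp h]
      rintro ⟨⟩; exact h3 rfl
  have hx' := key x q e h1 h2 h3 hm1
  have hy' := key y q' e' h1' h2' h3' hm3
  have hsub := T.Cs_sub_hs hmp (S := {f | f ≠ T.dir m p}) (by simp)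
  have hd : T.dir p m = d := by
    have := hsub hx'
    rw [mem_hs] at this hx
    rw [hx] at this
    exact (Option.some.inj this).symm
  rw [hd] at hsub
  exact ⟨_, hsub, hx', hy', T.isPreconnected_Cs _ _⟩

theorem setComponents_br [Finite Δ] [Nonempty Δ] (p : B) :
    setComponents T.X {T.br p}ᶜ = Set.range (T.hs p) := by
  have key : ∀ x d, x ∈ T.hs p d → connectedComponentIn {T.br p}ᶜ x = T.hs p d := by
    intro x d hx
    have hne : ∀ y ∈ T.hs p d, y ∈ ({T.br p}ᶜ : Set T.X) := by
      rintro y hy rfl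
      rw [mem_hs, br_self] at hy
      simp at hy
    apply Set.Subset.antisymm
    · intro y hy
      have := T.conn_dir (isPreconnected_connectedComponentIn (F := {T.br p}ᶜ) (x := x)) (q := p)
        (fun h => connectedComponentIn_subset _ _ h rfl) hy (mem_connectedComponentIn (hne x hx))
      rw [mem_hs, this]; exact hx
    · exact (T.isPreconnected_hs p d).subset_connectedComponentIn hx hne
  ext C
  constructor
  · rintro ⟨x, hx, rfl⟩
    obtain ⟨d, hd⟩ := T.exists_dir (x := x) (p := p) hx
    exact ⟨d, (key x d hd).symm⟩
  · rintro ⟨d, rfl⟩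
    obtain ⟨q, hq, hd⟩ := T.surj p d
    have hm : T.br q ∈ T.hs p d := by rw [mem_hs, br_ne _ (Ne.symm hq), hd]
    refine ⟨T.br q, ?_, (key _ _ hm).symm⟩
    intro h
    exact hq (T.br_inj h)

theorem ptOrder_br [Finite Δ] [Nonempty Δ] (p : B) : ptOrder T.X (T.br p) = Nat.card Δ := by
  rw [ptOrder, setComponents_br, ← Set.image_univ, Set.ncard_image_of_injective, Set.ncard_univ]
  intro d e hde
  obtain ⟨q, hq, hd⟩ := T.surj p d
  have hm : T.br q ∈ T.hs p d := by rw [mem_hs, br_ne _ (Ne.symm hq), hd]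
  have hm2 := hm
  rw [show T.hs p d = T.hs p e from hde] at hm2
  rw [mem_hs] at hm hm2
  rw [hm] at hm2
  exact Option.some.inj hm2

theorem ncard_one_or_two {α : Type*} {S : Set α} (hne : S.Nonempty)
    (h : ∀ a ∈ S, ∀ b ∈ S, ∀ c ∈ S, a = b ∨ b = c ∨ a = c) : S.ncard = 1 ∨ S.ncard = 2 := by
  obtain ⟨a, ha⟩ := hne
  by_cases h1 : ∃ b ∈ S, b ≠ a
  · obtain ⟨b, hb, hba⟩ := h1
    right
    have : S = {a, b} := by
      ext c
      constructor
      · intro hc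
        rcases h a ha b hb c hc with h | h | h
        · exact absurd h.symm hba
        · right; exact h.symm
        · left; exact h.symm
      · rintro (rfl | rfl) <;> assumption
    rw [this, Set.ncard_pair (Ne.symm hba)]
  · push Not at h1
    left
    have : S = {a} := by
      ext c
      exact ⟨fun hc => h1 c hc, by rintro rfl; exact ha⟩
    rw [this, Set.ncard_singleton]

theorem ptOrder_other [Finite Δ] [Nonempty Δ] [Nonempty B] (z : T.X) (hz : ∀ p, z ≠ T.br p) :
    ptOrder T.X z = 1 ∨ ptOrder T.X z = 2 := by
  have hsh : ∀ x ∈ ({z}ᶜ : Set T.X), ∃ q, connectedComponentIn {z}ᶜ x = connectedComponentIn {z}ᶜ (T.br q) := by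
    intro x hx
    obtain ⟨q, h1, h2, h3⟩ := T.sep hx
    refine ⟨q, (connectedComponentIn_eq ?_)⟩
    refine (T.isPreconnected_Cs q {d | z.1 q ≠ some d}).subset_connectedComponentIn ?_ ?_ (T.br_mem_Cs _ _)
    · obtain ⟨d, hd⟩ := Option.ne_none_iff_exists'.1 h2
      exact Or.inr ⟨d, by rw [hd] at h1; exact h1.symm, hd⟩
    · rintro y hy rfl
      rcases hy with hy | ⟨d, hd, hy⟩
      · exact h3 hy
      · exact hd hy
  have hmer : ∀ m q, (m = q ∨ z.1 m ≠ some (T.dir m q)) →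
      connectedComponentIn {z}ᶜ (T.br m) = connectedComponentIn {z}ᶜ (T.br q) := by
    intro m q h
    by_cases hmq : m = q
    · rw [hmq]
    replace h := h.resolve_left hmq
    apply connectedComponentIn_eq
    refine (T.isPreconnected_Cs m {d | z.1 m ≠ some d}).subset_connectedComponentIn (T.br_mem_Cs _ _) ?_ ?_
    · rintro y hy rfl
      rcases hy with hy | ⟨d, hd, hy⟩
      · exact hz m ((T.eq_br_iff _ _).2 hy)
      · exact hd hy
    · exact Or.inr ⟨_, h, T.br_ne hmq⟩
  apply ncard_one_or_two
  · exact ⟨_, T.br (Classical.arbitrary B), (hz _).symm, rfl⟩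
  · rintro _ ⟨a, ha, rfl⟩ _ ⟨b, hb, rfl⟩ _ ⟨c, hc, rfl⟩
    obtain ⟨p, hp⟩ := hsh a ha
    obtain ⟨q, hq⟩ := hsh b hb
    obtain ⟨r, hr⟩ := hsh c hc
    rw [hp, hq, hr]
    obtain ⟨m, h1, h2, h3⟩ := T.med p q r
    have e1 := hmer m p
    have e2 := hmer m q
    have e3 := hmer m r
    obtain ⟨d, hd⟩ := T.exists_dir (hz m)
    rw [hd] at e1 e2 e3
    simp only [ne_eq, Option.some.injEq] at e1 e2 e3
    by_cases f1 : (m = p ∨ ¬ d = T.dir m p)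
    · by_cases f2 : (m = q ∨ ¬ d = T.dir m q)
      · left; rw [← e1 f1, e2 f2]
      · by_cases f3 : (m = r ∨ ¬ d = T.dir m r)
        · right; right; rw [← e1 f1, e3 f3]
        · exfalso; push Not at f2 f3; rcases h2 with h | h | h
          · exact f2.1 h
          · exact f3.1 h
          · exact h (f2.2.symm.trans f3.2)
    · by_cases f2 : (m = q ∨ ¬ d = T.dir m q)
      · by_cases f3 : (m = r ∨ ¬ d = T.dir m r)
        · right; left; rw [← e2 f2, e3 f3]
        · exfalso; push Not at f1 f3; rcases h3 with h | h | h
          · exact f1.1 h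
          · exact f3.1 h
          · exact h (f1.2.symm.trans f3.2)
      · exfalso; push Not at f1 f2; rcases h1 with h | h | h
        · exact f1.1 h
        · exact f2.1 h
        · exact h (f1.2.symm.trans f2.2)

theorem _root_.Circle.isPreconnected_compl (c : Circle) : IsPreconnected ({c}ᶜ : Set Circle) := by
  obtain ⟨t, ht⟩ : ∃ t, Circle.exp t = c := Circle.exp_surjective c
  have : ({c}ᶜ : Set Circle) = Circle.exp '' Set.Ioo t (t + 2 * Real.pi) := by
    ext z
    constructor
    · intro hz
      obtain ⟨s, hs⟩ : ∃ s, Circle.exp s = z := Circle.exp_surjective z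
      obtain ⟨u, hu, hsu⟩ := Circle.periodic_exp.exists_mem_Ico Real.two_pi_pos s t
      refine ⟨u, ⟨lt_of_le_of_ne hu.1 ?_, hu.2⟩, by rw [← hsu, hs]⟩
      rintro rfl
      exact hz (by rw [Set.mem_singleton_iff, ← ht, ← hsu, hs])
    · rintro ⟨u, hu, rfl⟩ hcon
      have h1 : Circle.exp u = Circle.exp t := hcon.trans ht.symm
      obtain ⟨m, hm⟩ := Circle.exp_eq_exp.1 h1
      have hpi := Real.two_pi_pos
      have h0 : (0:ℝ) < m := by
        by_contra hh
        push Not at hh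
        nlinarith [hu.1]
      have h2 : (m:ℝ) < 1 := by
        by_contra hh
        push Not at hh
        nlinarith [hu.2]
      have h0' : 0 < m := by exact_mod_cast h0
      have h2' : m < 1 := by exact_mod_cast h2
      omega
  rw [this]
  exact isPreconnected_Ioo.image _ Circle.exp.continuous.continuousOn

theorem isDendrite [Countable B] [Finite Δ] [Nonempty Δ] [Nonempty B] : IsDendrite T.X := by
  refine ⟨⟨T.br (Classical.arbitrary B)⟩, inferInstance, ?_, inferInstance,
    TopologicalSpace.metrizableSpace_of_t3_secondCountable _, ?_⟩
  · exact { toNonempty := ⟨T.br (Classical.arbitrary B)⟩ }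
  · intro S
    constructor
    intro h
    have h1 : (1 : Circle) ≠ -1 := by
      intro h
      have := congrArg (fun z : Circle => (z : ℂ)) h
      norm_num [Circle.coe_neg] at this
    have hxy : (h.symm 1).1 ≠ (h.symm (-1)).1 := fun hh => h1 (h.symm.injective (Subtype.ext hh))
    obtain ⟨p, hp1, hp2, hp3⟩ := T.sep hxy
    have key : ∃ c : Circle, (c ≠ 1 ∧ c ≠ -1 ∧ ∀ d, (h.symm d).1 = T.br p → d = c) ∨
        (∀ d, (h.symm d).1 ≠ T.br p) := by
      by_cases hh : ∃ c, (h.symm c).1 = T.br p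
      · obtain ⟨c, hc⟩ := hh
        refine ⟨c, Or.inl ⟨?_, ?_, ?_⟩⟩
        · rintro rfl; exact hp2 ((T.eq_br_iff _ _).1 hc)
        · rintro rfl; exact hp3 ((T.eq_br_iff _ _).1 hc)
        · intro d hd; exact h.symm.injective (Subtype.ext (hd.trans hc.symm))
      · push Not at hh
        exact ⟨1, Or.inr hh⟩
    have hc : Continuous fun d => (h.symm d).1 := continuous_subtype_val.comp h.symm.continuous
    obtain ⟨c, ⟨hc1, hc2, hc3⟩ | hcc⟩ := key
    · have := (Circle.isPreconnected_compl c).image _ hc.continuousOn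
      exact hp1 (T.conn_dir this (q := p) (by rintro ⟨d, hd, hd2⟩; exact hd (hc3 d hd2))
        ⟨1, hc1.symm, rfl⟩ ⟨-1, hc2.symm, rfl⟩)
    · have hu : IsPreconnected (Set.univ : Set Circle) := by
        have : (Set.univ : Set Circle) = Circle.exp '' Set.univ := by
          rw [Set.image_univ, Circle.exp_surjective.range_eq]
        rw [this]
        exact isPreconnected_univ.image _ Circle.exp.continuous.continuousOn
      have := hu.image _ hc.continuousOn
      exact hp1 (T.conn_dir this (q := p) (by rintro ⟨d, hd, hd2⟩; exact hcc d hd2)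
        ⟨1, trivial, rfl⟩ ⟨-1, trivial, rfl⟩)

theorem isWazewski [Countable B] [Finite Δ] [Nonempty Δ] [Nonempty B] :
    IsWazewskiDendrite (Nat.card Δ) T.X := by
  refine ⟨T.isDendrite, fun z => ?_, fun A hA => ?_⟩
  · by_cases h : ∃ p, z = T.br p
    · obtain ⟨p, rfl⟩ := h
      exact Or.inr (Or.inr (T.ptOrder_br p))
    · push Not at h
      rcases T.ptOrder_other z h with h | h
      · exact Or.inl h
      · exact Or.inr (Or.inl h)
  · obtain ⟨h⟩ := hA
    have hxy : (h.symm 0).1 ≠ (h.symm 1).1 := fun hh =>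
      zero_ne_one (h.symm.injective (Subtype.ext hh))
    obtain ⟨p, hp1, hp2, hp3⟩ := T.sep hxy
    refine ⟨T.br p, ?_, T.ptOrder_br p⟩
    by_contra hA
    have hc : Continuous fun d => (h.symm d).1 := continuous_subtype_val.comp h.symm.continuous
    have := isPreconnected_univ.image _ hc.continuousOn
    exact hp1 (T.conn_dir this (q := p) (by rintro ⟨d, -, hd⟩; exact hA (hd ▸ (h.symm d).2))
        ⟨0, trivial, rfl⟩ ⟨1, trivial, rfl⟩)

theorem ptOrder_eq_iff [Finite Δ] [Nonempty Δ] [Nonempty B] (hc : 3 ≤ Nat.card Δ) (x : T.X) :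
    ptOrder T.X x = Nat.card Δ ↔ ∃ p, x = T.br p := by
  constructor
  · intro h
    by_contra hcon
    push Not at hcon
    have := T.ptOrder_other x hcon
    omega
  · rintro ⟨p, rfl⟩; exact T.ptOrder_br p

end DTree

theorem perm_ai {B : Type*} (f : Equiv.Perm B) (x : B) : f (f⁻¹ x) = x := by simp

theorem perm_ia {B : Type*} (f : Equiv.Perm B) (x : B) : f⁻¹ (f x) = x := by simp

namespace DTree

variable {B Δ : Type} (T : DTree B Δ)

/-- Automorphisms of the branch point structure. -/
def Aut : Subgroup (Equiv.Perm B) where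
  carrier := {f | ∀ p q r, q ≠ p → r ≠ p →
    (T.dir p q = T.dir p r ↔ T.dir (f p) (f q) = T.dir (f p) (f r))}
  one_mem' := fun _ _ _ _ _ => Iff.rfl
  mul_mem' := by
    intro f g hf hg p q r hq hr
    exact (hg p q r hq hr).trans (hf (g p) (g q) (g r) (g.injective.ne hq) (g.injective.ne hr))
  inv_mem' := by
    intro f hf p q r hq hr
    have := hf (f⁻¹ p) (f⁻¹ q) (f⁻¹ r) (f⁻¹.injective.ne hq) (f⁻¹.injective.ne hr)
    simp only [perm_ai] at this
    exact this.symm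

theorem mem_Aut {f : Equiv.Perm B} : f ∈ T.Aut ↔ ∀ p q r, q ≠ p → r ≠ p →
    (T.dir p q = T.dir p r ↔ T.dir (f p) (f q) = T.dir (f p) (f r)) := Iff.rfl

/-- Action on directions. -/
noncomputable def lam (f : Equiv.Perm B) (p : B) (d : Δ) : Δ :=
  T.dir (f p) (f (T.surj p d).choose)

theorem lam_spec {f : Equiv.Perm B} (hf : f ∈ T.Aut) {p q : B} (h : q ≠ p) :
    T.dir (f p) (f q) = T.lam f p (T.dir p q) := by
  have h2 := (T.surj p (T.dir p q)).choose_spec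
  exact (hf p q _ h h2.1).1 h2.2.symm

theorem lam_inj {f : Equiv.Perm B} (hf : f ∈ T.Aut) (p : B) : Function.Injective (T.lam f p) := by
  intro d e h
  obtain ⟨q, hq, rfl⟩ := T.surj p d
  obtain ⟨r, hr, rfl⟩ := T.surj p e
  rw [← T.lam_spec hf hq, ← T.lam_spec hf hr] at h
  exact (hf p q r hq hr).2 h

theorem lam_mul {f g : Equiv.Perm B} (hf : f ∈ T.Aut) (hg : g ∈ T.Aut) (p : B) (d : Δ) :
    T.lam (f * g) p d = T.lam f (g p) (T.lam g p d) := by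
  obtain ⟨q, hq, rfl⟩ := T.surj p d
  rw [← T.lam_spec (T.Aut.mul_mem hf hg) hq, ← T.lam_spec hg hq,
    ← T.lam_spec hf (g.injective.ne hq)]
  rfl

theorem lam_one (p : B) (d : Δ) : T.lam 1 p d = d := by
  obtain ⟨q, hq, rfl⟩ := T.surj p d
  rw [← T.lam_spec T.Aut.one_mem hq]
  rfl

/-- Action on the dendrite. -/
noncomputable def act (f : T.Aut) (x : T.X) : T.X :=
  ⟨fun p => (x.1 (f.1⁻¹ p)).map (T.lam f.1 (f.1⁻¹ p)), by
    obtain ⟨f, hf⟩ := f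
    have key : ∀ p q, p ≠ q → T.lam f (f⁻¹ p) (T.dir (f⁻¹ p) (f⁻¹ q)) = T.dir p q := by
      intro p q hpq
      rw [← T.lam_spec hf (f⁻¹.injective.ne hpq.symm)]
      simp
    constructor
    · intro p q hpq
      beta_reduce
      rcases x.2.1 (f⁻¹ p) (f⁻¹ q) (f⁻¹.injective.ne hpq) with h | h
      · left
        rw [h, Option.map_some, key p q hpq]
      · right
        rw [h, Option.map_some, key q p hpq.symm]
    · intro p hp
      beta_reduce at hp ⊢
      rw [x.2.2 (f⁻¹ p), Option.map_none]
      intro q hq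
      have h1 : f q ≠ p := by rintro rfl; simp at hq
      have h2 := hp (f q) h1
      rw [← key _ _ h1, ← Option.map_some, perm_ia] at h2
      exact Option.map_injective (T.lam_inj hf q) h2⟩

theorem act_val (f : T.Aut) (x : T.X) (p : B) :
    (T.act f x).1 p = (x.1 (f.1⁻¹ p)).map (T.lam f.1 (f.1⁻¹ p)) := rfl

theorem act_mul (f g : T.Aut) (x : T.X) : T.act (f * g) x = T.act f (T.act g x) := by
  apply X.ext'
  intro p
  rw [act_val, act_val, act_val, Option.map_map]
  have h : (f * g).1⁻¹ p = g.1⁻¹ (f.1⁻¹ p) := by simp [mul_inv_rev]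
  rw [h]
  congr 1
  funext d
  rw [Subgroup.coe_mul, T.lam_mul f.2 g.2, Function.comp, perm_ai]

theorem act_one (x : T.X) : T.act 1 x = x := by
  apply X.ext'
  intro p
  rw [act_val]
  have : T.lam (1 : T.Aut).1 ((1 : T.Aut).1⁻¹ p) = id := by
    funext d; exact T.lam_one _ d
  rw [this, Option.map_id]
  rfl

theorem act_br (f : T.Aut) (p : B) : T.act f (T.br p) = T.br (f.1 p) := by
  rw [eq_br_iff, act_val, perm_ia, br_self, Option.map_none]

theorem continuous_act (f : T.Aut) : Continuous (T.act f) := by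
  apply continuous_generateFrom_iff.2
  rintro _ ⟨⟨p, d⟩, rfl⟩
  have : T.act f ⁻¹' T.hs p d = ⋃ e : {e // T.lam f.1 (f.1⁻¹ p) e = d}, T.hs (f.1⁻¹ p) e := by
    ext x
    rw [Set.mem_preimage, mem_hs, act_val, Option.map_eq_some_iff, Set.mem_iUnion]
    constructor
    · rintro ⟨e, h1, h2⟩; exact ⟨⟨e, h2⟩, h1⟩
    · rintro ⟨⟨e, h2⟩, h1⟩; exact ⟨e, h1, h2⟩
  rw [this]
  exact isOpen_iUnion fun e => T.isOpen_hs _ _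

/-- Action by homeomorphisms. -/
noncomputable def Phi : T.Aut →* (T.X ≃ₜ T.X) where
  toFun f :=
    { toFun := T.act f
      invFun := T.act f⁻¹
      left_inv := fun x => by rw [← act_mul, inv_mul_cancel, act_one]
      right_inv := fun x => by rw [← act_mul, mul_inv_cancel, act_one]
      continuous_toFun := T.continuous_act f
      continuous_invFun := T.continuous_act f⁻¹ }
  map_one' := Homeomorph.ext fun x => T.act_one x
  map_mul' f g := Homeomorph.ext fun x => T.act_mul f g x

theorem Phi_br (f : T.Aut) (p : B) : T.Phi f (T.br p) = T.br (f.1 p) := T.act_br f p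

theorem Phi_injective : Function.Injective T.Phi := by
  intro f g h
  apply Subtype.ext
  apply Equiv.ext
  intro p
  apply T.br_inj
  rw [← Phi_br, ← Phi_br, h]

theorem ptOrder_homeo {X : Type*} [TopologicalSpace X] (h : X ≃ₜ X) (x : X) :
    ptOrder X (h x) = ptOrder X x := by
  have : setComponents X {h x}ᶜ = (fun S => h '' S) '' setComponents X {x}ᶜ := by
    have himg : h '' {x}ᶜ = {h x}ᶜ := by
      rw [Set.image_compl_eq h.bijective, Set.image_singleton]
    ext C
    constructor
    · rintro ⟨y, hy, rfl⟩
      refine ⟨_, ⟨h.symm y, ?_, rfl⟩, ?_⟩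
      · rintro rfl; simp at hy
      · beta_reduce
        rw [h.image_connectedComponentIn, himg, h.apply_symm_apply]
        rintro rfl; simp at hy
    · rintro ⟨_, ⟨y, hy, rfl⟩, rfl⟩
      refine ⟨h y, ?_, ?_⟩
      · intro hh; exact hy (h.injective hh)
      · beta_reduce
        rw [h.image_connectedComponentIn hy, himg]
  rw [ptOrder, ptOrder, this, Set.ncard_image_of_injective]
  exact Set.image_injective.2 h.injective

variable [Finite Δ] [Nonempty Δ]

theorem exists_aut [Nonempty B] (hc : 3 ≤ Nat.card Δ) (h : T.X ≃ₜ T.X) :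
    ∃ f ∈ T.Aut, ∀ p, h (T.br p) = T.br (f p) := by
  have h1 : ∀ (h : T.X ≃ₜ T.X) p, ∃ q, h (T.br p) = T.br q := by
    intro h p
    rw [← T.ptOrder_eq_iff hc, ptOrder_homeo, T.ptOrder_br]
  choose f hf using h1 h
  choose g hg using h1 h.symm
  have hfg : ∀ p, f (g p) = p := fun p => T.br_inj (by rw [← hf, ← hg, h.apply_symm_apply])
  have hgf : ∀ p, g (f p) = p := fun p => T.br_inj (by rw [← hg, ← hf, h.symm_apply_apply])
  have key : ∀ (h : T.X ≃ₜ T.X) (f : B → B), (∀ p, h (T.br p) = T.br (f p)) →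
      Function.Injective f → ∀ p q r,
      q ≠ p → r ≠ p → T.dir p q = T.dir p r → T.dir (f p) (f q) = T.dir (f p) (f r) := by
    intro h f hf hi p q r hq hr heq
    have hpre := (T.isPreconnected_hs p (T.dir p q)).image h h.continuous.continuousOn
    have := T.conn_dir hpre (q := f p) ?_ (x := T.br (f q)) (y := T.br (f r)) ?_ ?_
    · rw [br_ne _ (hi.ne hq.symm), br_ne _ (hi.ne hr.symm)] at this
      exact Option.some.inj this
    · rintro ⟨x, hx, hx2⟩
      rw [← hf] at hx2
      have := h.injective hx2
      subst this
      rw [mem_hs, br_self] at hx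
      simp at hx
    · exact ⟨T.br q, by rw [mem_hs, br_ne _ hq.symm], hf q⟩
    · exact ⟨T.br r, by rw [mem_hs, br_ne _ hr.symm, heq], hf r⟩
  refine ⟨⟨f, g, hgf, hfg⟩, ?_, hf⟩
  intro p q r hq hr
  constructor
  · exact key h f hf (Function.LeftInverse.injective hgf) p q r hq hr
  · intro hh
    have hi := Function.LeftInverse.injective hgf
    have := key h.symm g hg (Function.LeftInverse.injective hfg) (f p) (f q) (f r) (hi.ne hq) (hi.ne hr) hh
    rwa [hgf, hgf, hgf] at this

open Filter in
theorem dense_of [Nonempty B] (hc : 3 ≤ Nat.card Δ) (Γ : Subgroup (Equiv.Perm B)) (hΓ : Γ ≤ T.Aut)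
    (hh : ∀ f ∈ T.Aut, ∀ E : Finset B, ∃ γ ∈ Γ, ∀ e ∈ E, γ e = f e) :
    Dense ((T.Phi.comp (Subgroup.inclusion hΓ)).range : Set (T.X ≃ₜ T.X)) := by
  classical
  intro h
  obtain ⟨f, hf, hfb⟩ := T.exists_aut hc h
  choose γ hγ hγE using hh f hf
  let F : Finset B → (T.X ≃ₜ T.X) := fun E => T.Phi ⟨γ E, hΓ (hγ E)⟩
  have hFb : ∀ E p, F E (T.br p) = T.br (γ E p) := fun E p => T.Phi_br _ p
  have hmem : ∀ E, F E ∈ ((T.Phi.comp (Subgroup.inclusion hΓ)).range : Set (T.X ≃ₜ T.X)) :=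
    fun E => ⟨⟨γ E, hγ E⟩, rfl⟩
  refine mem_closure_of_tendsto (f := F) (b := atTop) ?_ (Eventually.of_forall hmem)
  rw [nhds_induced, tendsto_comap_iff, ContinuousMap.tendsto_nhds_compactOpen]
  intro K hK U hU hKU
  have hloc : ∀ x, h x ∈ U → ∃ t ∈ nhds x, ∀ᶠ E in atTop, Set.MapsTo (F E) t U := by
    have hU' : TopologicalSpace.GenerateOpen (Set.range fun a : B × Δ => T.hs a.1 a.2) U := hU
    clear hKU hU
    induction hU' with
    | basic s hs =>
      obtain ⟨⟨p, d⟩, rfl⟩ := hs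
      intro x hx
      obtain ⟨w, hw, hwd⟩ := T.surj p d
      have hwm : T.br w ∈ T.hs p d := by rw [mem_hs, br_ne _ hw.symm, hwd]
      refine ⟨h ⁻¹' T.hs p d, ((T.isOpen_hs p d).preimage h.continuous).mem_nhds hx, ?_⟩
      refine eventually_atTop.2 ⟨{f⁻¹ p, f⁻¹ w}, fun E hE => ?_⟩
      have e1 : γ E (f⁻¹ p) = p := by rw [hγE E _ (hE (by simp))]; simp
      have e2 : γ E (f⁻¹ w) = w := by rw [hγE E _ (hE (by simp))]; simp
      have b1 : h (T.br (f⁻¹ p)) = T.br p := by rw [hfb]; simp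
      have b2 : h (T.br (f⁻¹ w)) = T.br w := by rw [hfb]; simp
      have hpre : IsPreconnected (h ⁻¹' T.hs p d) := by
        rw [← h.image_symm]
        exact (T.isPreconnected_hs p d).image _ h.symm.continuous.continuousOn
      have hpre2 := hpre.image (F E) (F E).continuous.continuousOn
      intro y hy
      have := T.conn_dir hpre2 (q := p) ?_ (x := F E y) (y := T.br w) ⟨y, hy, rfl⟩
        ⟨T.br (f⁻¹ w), ?_, ?_⟩
      · rw [mem_hs, this]; exact hwm
      · rintro ⟨z, hz, hz2⟩
        have : z = T.br (f⁻¹ p) := (F E).injective (by rw [hz2, hFb, e1])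
        subst this
        rw [Set.mem_preimage, b1, mem_hs, br_self] at hz
        simp at hz
      · rw [Set.mem_preimage, b2]; exact hwm
      · rw [hFb, e2]
    | univ => exact fun x _ => ⟨Set.univ, univ_mem, Eventually.of_forall fun E => Set.mapsTo_univ _ _⟩
    | inter s t hs ht ihs iht =>
      intro x hx
      obtain ⟨V, h1, h2⟩ := ihs x hx.1
      obtain ⟨W, h3, h4⟩ := iht x hx.2
      refine ⟨V ∩ W, inter_mem h1 h3, ?_⟩
      filter_upwards [h2, h4] with E a b
      exact fun y hy => ⟨a hy.1, b hy.2⟩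
    | sUnion S hS ih =>
      rintro x ⟨s, hs, hxs⟩
      obtain ⟨V, h1, h2⟩ := ih s hs x hxs
      refine ⟨V, h1, ?_⟩
      filter_upwards [h2] with E a
      exact fun y hy => ⟨s, hs, a hy⟩
  refine hK.induction_on (p := fun K' => ∀ᶠ E in atTop, Set.MapsTo (F E) K' U) ?_ ?_ ?_ ?_
  · exact Eventually.of_forall fun E => Set.mapsTo_empty _ _
  · intro s t hst ht
    filter_upwards [ht] with E a
    exact fun y hy => a (hst hy)
  · intro s t hs ht
    filter_upwards [hs, ht] with E a b
    exact a.union b |>.mono_right (by simp)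
  · intro x hx
    obtain ⟨t, ht, hE⟩ := hloc x (hKU hx)
    exact ⟨t, mem_nhdsWithin_of_mem_nhds ht, hE⟩

end DTree

/-- Not invariably generated. -/
def NonIG (G : Type*) [Group G] : Prop :=
  ∃ H : Subgroup G, H ≠ ⊤ ∧ ∀ x : G, ∃ g : G, g * x * g⁻¹ ∈ H

theorem NonIG.of_equiv {G G' : Type*} [Group G] [Group G'] (e : G ≃* G') (h : NonIG G) : NonIG G' := by
  obtain ⟨H, h1, h2⟩ := h
  refine ⟨H.comap e.symm.toMonoidHom, ?_, fun x => ?_⟩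
  · intro hcon
    apply h1
    rw [Subgroup.eq_top_iff'] at hcon ⊢
    intro x
    have := hcon (e x)
    simpa using this
  · obtain ⟨g, hg⟩ := h2 (e.symm x)
    refine ⟨e g, ?_⟩
    rw [Subgroup.mem_comap]
    simpa using hg

theorem nonIG_commutator_of_equiv {G G' : Type*} [Group G] [Group G'] (e : G ≃* G')
    (h : NonIG (commutator G)) : NonIG (commutator G') := by
  have : (commutator G).map e.toMonoidHom = commutator G' := by
    rw [commutator_def, commutator_def, Subgroup.map_commutator, Subgroup.map_top_of_surjective]
    exact e.surjective
  rw [← this]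
  exact h.of_equiv (e.subgroupMap (commutator G))

/-- Dyadic rationals. -/
def DyS : AddSubgroup ℚ where
  carrier := {x | ∃ (k : ℕ) (m : ℤ), 2 ^ k * x = m}
  zero_mem' := ⟨0, 0, by simp⟩
  add_mem' := by
    rintro a b ⟨k, m, h⟩ ⟨l, n, h'⟩
    refine ⟨k + l, 2 ^ l * m + 2 ^ k * n, ?_⟩
    push_cast
    rw [← h, ← h']
    ring
  neg_mem' := by
    rintro a ⟨k, m, h⟩
    exact ⟨k, -m, by push_cast; rw [← h]; ring⟩

/-- Dyadic rationals as a type. -/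
abbrev Dy : Type := DyS

namespace Dy

theorem ex (x : Dy) : ∃ (k : ℕ) (m : ℤ), 2 ^ k * x.1 = m := x.2

/-- Half of a dyadic. -/
def half (x : Dy) : Dy := ⟨x.1 / 2, by
  obtain ⟨k, m, h⟩ := x.2
  exact ⟨k + 1, m, by rw [← h]; ring⟩⟩

theorem half_add (x : Dy) : half x + half x = x := Subtype.ext (by simp [half])

theorem half_dbl (x : Dy) : half (x + x) = x := Subtype.ext (by simp [half])

theorem half_pos {x : Dy} : 0 < half x ↔ 0 < x := by
  rw [← Subtype.coe_lt_coe, ← Subtype.coe_lt_coe]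
  simp [half]

instance : Zero Dy := inferInstance

/-- The dyadic one. -/
def one : Dy := ⟨1, 0, 1, by simp⟩

theorem one_pos : (0 : Dy) < one := by
  rw [← Subtype.coe_lt_coe]; simp [one]

instance : Countable Dy := inferInstance

instance : Nontrivial Dy := ⟨⟨0, one, one_pos.ne⟩⟩

instance : NoMinOrder Dy := ⟨fun a => ⟨a - one, by simpa using one_pos⟩⟩
instance : NoMaxOrder Dy := ⟨fun a => ⟨a + one, by simpa using one_pos⟩⟩
instance : DenselyOrdered Dy := ⟨fun a b h => ⟨half (a + b), by
  rw [← Subtype.coe_lt_coe] at h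
  constructor <;> rw [← Subtype.coe_lt_coe] <;> simp only [half, AddSubgroup.coe_add] <;> linarith⟩⟩

/-- Translation. -/
def shift (c : Dy) : Dy ≃o Dy := OrderIso.addRight c

theorem shift_apply (c x : Dy) : shift c x = x + c := rfl

/-- Doubling. -/
def dbl : Dy ≃o Dy where
  toFun x := x + x
  invFun := half
  left_inv := half_dbl
  right_inv := half_add
  map_rel_iff' := by
    intro a b
    show a + a ≤ b + b ↔ a ≤ b
    rw [← Subtype.coe_le_coe, ← Subtype.coe_le_coe]
    simp only [AddSubgroup.coe_add]
    constructor <;> intro h <;> linarith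

theorem dbl_apply (x : Dy) : dbl x = x + x := rfl

/-- Doubling on the positive part. -/
def g0 : Dy ≃o Dy where
  toFun x := if 0 < x then x + x else x
  invFun x := if 0 < x then half x else x
  left_inv := by
    intro x
    by_cases h : 0 < x
    · have : 0 < x + x := add_pos h h
      simp only [h, this, if_true, half_dbl]
    · simp only [h, if_false]
  right_inv := by
    intro x
    by_cases h : 0 < x
    · have : 0 < half x := half_pos.2 h
      simp only [h, this, if_true, half_add]
    · simp only [h, if_false]
  map_rel_iff' := by
    intro a b
    show (if 0 < a then a + a else a) ≤ (if 0 < b then b + b else b) ↔ a ≤ b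
    have hq : ∀ x y : Dy, x ≤ y ↔ x.1 ≤ y.1 := fun x y => Iff.rfl
    have hl : ∀ x y : Dy, x < y ↔ x.1 < y.1 := fun x y => Iff.rfl
    split_ifs with h1 h2 h2 <;> simp only [hq] <;>
      simp only [hl, AddSubgroup.coe_add, AddSubgroup.coe_zero] at * <;>
      constructor <;> intro h <;> linarith

theorem g0_pos {x : Dy} (h : 0 < x) : g0 x = x + x := if_pos h
theorem g0_neg {x : Dy} (h : x ≤ 0) : g0 x = x := if_neg (not_lt.2 h)

/-- Generators. -/
def gens : Set (Dy ≃o Dy) := {shift one, dbl, g0}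

/-- The group. -/
def F : Subgroup (Dy ≃o Dy) := Subgroup.closure gens

theorem shift_one_mem : shift one ∈ F := Subgroup.subset_closure (by simp [gens])
theorem dbl_mem : dbl ∈ F := Subgroup.subset_closure (by simp [gens])
theorem g0_mem : g0 ∈ F := Subgroup.subset_closure (by simp [gens])

theorem shift_add (a b : Dy) : shift (a + b) = shift a * shift b := by
  ext x
  simp only [RelIso.mul_apply, shift_apply]
  rw [add_comm a b, add_assoc]

theorem shift_neg (a : Dy) : shift (-a) = (shift a)⁻¹ := by
  rw [eq_inv_iff_mul_eq_one, ← shift_add]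
  ext x
  simp [shift_apply]

theorem shift_nat (n : ℕ) (x : Dy) (h : x.1 = n) : shift x ∈ F := by
  induction n generalizing x with
  | zero =>
    have : x = 0 := Subtype.ext (by simpa using h)
    subst this
    convert F.one_mem
    ext x; simp [shift_apply]
  | succ k ih =>
    have : x = (x - one) + one := by simp
    rw [this, shift_add]
    refine F.mul_mem (ih _ ?_) shift_one_mem
    simp [h, one]

theorem shift_int (n : ℤ) (x : Dy) (h : x.1 = n) : shift x ∈ F := by
  obtain ⟨m, rfl | rfl⟩ := n.eq_nat_or_neg
  · exact shift_nat m x (by simpa using h)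
  · have := F.inv_mem (shift_nat m (-x) (by simp [h]))
    rwa [← shift_neg, neg_neg] at this

theorem shift_mem (x : Dy) : shift x ∈ F := by
  obtain ⟨k, m, h⟩ := x.ex
  induction k generalizing x with
  | zero => exact shift_int m x (by simpa using h)
  | succ k ih =>
    have h1 := ih (x + x) (by rw [← h, AddSubgroup.coe_add]; ring)
    have : shift x = dbl⁻¹ * shift (x + x) * dbl := by
      rw [mul_assoc, eq_inv_mul_iff_mul_eq]
      ext y
      simp only [RelIso.mul_apply, shift_apply, dbl_apply]
      abel_nf
    rw [this]
    exact F.mul_mem (F.mul_mem (F.inv_mem dbl_mem) h1) dbl_mem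

theorem inv_fix (f : Dy ≃o Dy) {x y : Dy} (h : f x = y) : f⁻¹ y = x := by
  rw [← h]; exact f.symm_apply_apply x

/-- Elements of `F` fixing everything up to `c`. -/
def Fc (c : Dy) : Subgroup (Dy ≃o Dy) where
  carrier := {f | f ∈ F ∧ ∀ z ≤ c, f z = z}
  one_mem' := ⟨F.one_mem, fun _ _ => rfl⟩
  mul_mem' := by
    rintro f g ⟨h1, h2⟩ ⟨h3, h4⟩
    exact ⟨F.mul_mem h1 h3, fun z hz => by rw [RelIso.mul_apply, h4 z hz, h2 z hz]⟩
  inv_mem' := by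
    rintro f ⟨h1, h2⟩
    exact ⟨F.inv_mem h1, fun z hz => inv_fix f (h2 z hz)⟩

/-- Doubling to the right of one. -/
def g1 : Dy ≃o Dy := shift one * g0 * (shift one)⁻¹

theorem g1_apply {x : Dy} (h : one < x) : g1 x = x + x - one := by
  rw [g1, ← shift_neg, RelIso.mul_apply, RelIso.mul_apply, shift_apply, shift_apply, g0_pos]
  · abel
  · rw [← sub_eq_add_neg]; exact sub_pos.2 h

theorem g1_mem : g1 ∈ Fc 0 := by
  refine ⟨F.mul_mem (F.mul_mem shift_one_mem g0_mem) (F.inv_mem shift_one_mem), fun z hz => ?_⟩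
  rw [g1, ← shift_neg, RelIso.mul_apply, RelIso.mul_apply, shift_apply, shift_apply, g0_neg]
  · abel
  · rw [← sub_eq_add_neg]; exact sub_nonpos.2 (hz.trans one_pos.le)

theorem g0_mem' : g0 ∈ Fc 0 := ⟨g0_mem, fun _ hz => g0_neg hz⟩

theorem to_one_nat (n : ℕ) (hn : 0 < n) (x : Dy) (h : x.1 = n) : ∃ f ∈ Fc 0, f x = one := by
  induction n using Nat.strong_induction_on generalizing x with
  | _ n ih =>
    rcases Nat.even_or_odd' n with ⟨m, rfl | rfl⟩
    · have hx : half x = ⟨(m : ℚ), 0, m, by simp⟩ := Subtype.ext (by simp [half, h])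
      obtain ⟨f, hf, hf1⟩ := ih m (by omega) (by omega) (half x) (by rw [hx])
      refine ⟨f * g0⁻¹, (Fc 0).mul_mem hf ((Fc 0).inv_mem g0_mem'), ?_⟩
      rw [RelIso.mul_apply, inv_fix g0 (x := half x), hf1]
      rw [g0_pos, half_add]
      rw [← Subtype.coe_lt_coe, hx]
      simpa using (by omega : 0 < m)
    · rcases Nat.eq_zero_or_pos m with rfl | hm
      · exact ⟨1, (Fc 0).one_mem, Subtype.ext (by simp [h, one])⟩
      · let y : Dy := ⟨(m : ℚ) + 1, 0, m + 1, by simp⟩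
        obtain ⟨f, hf, hf1⟩ := ih (m + 1) (by omega) (by omega) y (by simp [y])
        refine ⟨f * g1⁻¹, (Fc 0).mul_mem hf ((Fc 0).inv_mem g1_mem), ?_⟩
        rw [RelIso.mul_apply, inv_fix g1 (x := y), hf1]
        rw [g1_apply]
        · apply Subtype.ext
          rw [h]; simp [y, one]; ring
        · rw [← Subtype.coe_lt_coe]
          simpa [y, one] using hm

theorem to_one (x : Dy) (hx : 0 < x) : ∃ f ∈ Fc 0, f x = one := by
  obtain ⟨k, m, h⟩ := x.ex
  induction k generalizing x with
  | zero =>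
    rw [← Subtype.coe_lt_coe] at hx
    simp only [pow_zero, one_mul] at h
    rw [h] at hx
    have hm : 0 < m := by simpa using hx
    exact to_one_nat m.toNat (by omega) x (by rw [h]; exact_mod_cast (Int.toNat_of_nonneg hm.le).symm)
  | succ k ih =>
    obtain ⟨f, hf, hf1⟩ := ih (x + x) (add_pos hx hx) (by rw [← h, AddSubgroup.coe_add]; ring)
    exact ⟨f * g0, (Fc 0).mul_mem hf g0_mem', by rw [RelIso.mul_apply, g0_pos hx, hf1]⟩

theorem F_local (c x y : Dy) (hx : c < x) (hy : c < y) :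
    ∃ f ∈ F, (∀ z ≤ c, f z = z) ∧ f x = y := by
  obtain ⟨f, hf, hf1⟩ := to_one (x - c) (sub_pos.2 hx)
  obtain ⟨g, hg, hg1⟩ := to_one (y - c) (sub_pos.2 hy)
  have hk := (Fc 0).mul_mem ((Fc 0).inv_mem hg) hf
  refine ⟨shift c * (g⁻¹ * f) * shift (-c), F.mul_mem (F.mul_mem (shift_mem _) hk.1) (shift_mem _),
    fun z hz => ?_, ?_⟩
  · rw [RelIso.mul_apply, RelIso.mul_apply, shift_apply, shift_apply, hk.2]
    · abel
    · rw [← sub_eq_add_neg]; exact sub_nonpos.2 hz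
  · rw [RelIso.mul_apply, RelIso.mul_apply, shift_apply, shift_apply, ← sub_eq_add_neg,
      RelIso.mul_apply, hf1, inv_fix g hg1]
    abel

theorem F_ext (E : Finset Dy) (φ : Dy → Dy) (h : StrictMonoOn φ E) :
    ∃ f ∈ F, ∀ e ∈ E, f e = φ e := by
  classical
  induction E using Finset.induction_on_max with
  | empty => exact ⟨1, F.one_mem, by simp⟩
  | insert a s hs ih =>
    obtain ⟨f, hf, hfe⟩ := ih (h.mono (by simp))
    by_cases hne : s.Nonempty
    · let b := s.max' hne
      have hb : b ∈ s := s.max'_mem hne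
      obtain ⟨k, hk, hk1, hk2⟩ := F_local (f b) (f a) (φ a) (f.strictMono (hs b hb)) (by
        rw [hfe b hb]
        exact h (by simp [hb]) (by simp) (hs b hb))
      refine ⟨k * f, F.mul_mem hk hf, fun e he => ?_⟩
      rcases Finset.mem_insert.1 he with rfl | he
      · exact hk2
      · rw [RelIso.mul_apply, hk1, hfe e he]
        exact f.monotone (s.le_max' e he)
    · rw [Finset.not_nonempty_iff_eq_empty] at hne
      subst hne
      obtain ⟨c, hc⟩ := exists_lt (min a (φ a))
      obtain ⟨k, hk, hk1, hk2⟩ := F_local c a (φ a) (hc.trans_le (min_le_left _ _))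
        (hc.trans_le (min_le_right _ _))
      exact ⟨k, hk, by simpa using hk2⟩

theorem F_trans (x y : Dy) : ∃ f ∈ F, f x = y := by
  obtain ⟨c, hc⟩ := exists_lt (min x y)
  obtain ⟨k, hk, -, hk2⟩ := F_local c x y (hc.trans_le (min_le_left _ _))
    (hc.trans_le (min_le_right _ _))
  exact ⟨k, hk, hk2⟩

end Dy

/-- Concrete branch points. -/
inductive Bt (J : Type) : Type
  | tip (a : Dy) : Bt J
  | ext (a : Dy) (j : J) (b : Bt J) : Bt J

/-- Directions. -/
abbrev Dl (J : Type) : Type := Bool ⊕ J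

namespace Bt

variable {J : Type}

/-- Left. -/
abbrev lft : Dl J := Sum.inl false
/-- Right. -/
abbrev rgt : Dl J := Sum.inl true

/-- Head. -/
def hd : Bt J → Dy
  | tip a => a
  | ext a _ _ => a

/-- Direction of a point above its head. -/
def off : Bt J → Dl J
  | tip _ => lft
  | ext _ j _ => Sum.inr j

open Classical in
/-- Direction. -/
noncomputable def dir : Bt J → Bt J → Dl J
  | tip a, q => if q.hd < a then lft else if a < q.hd then rgt else q.off
  | ext a j b, q => match q with
    | tip _ => lft
    | ext a' j' b' => if a = a' ∧ j = j' then dir b b' else lft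

theorem dir_tip_lt {a : Dy} {q : Bt J} (h : q.hd < a) : dir (tip a) q = lft := by
  rw [dir, if_pos h]
theorem dir_tip_gt {a : Dy} {q : Bt J} (h : a < q.hd) : dir (tip a) q = rgt := by
  rw [dir, if_neg (not_lt.2 h.le), if_pos h]
theorem dir_tip_ext (a : Dy) (j : J) (b : Bt J) : dir (tip a) (ext a j b) = Sum.inr j := by
  rw [dir, if_neg, if_neg] <;> simp [hd, off]
theorem dir_ext_tip (a : Dy) (j : J) (b : Bt J) (c : Dy) : dir (ext a j b) (tip c) = lft := by
  rw [dir]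
theorem dir_ext_same (a : Dy) (j : J) (b b' : Bt J) : dir (ext a j b) (ext a j b') = dir b b' := by
  rw [dir]; simp
theorem dir_ext_ne {a : Dy} {j : J} {b : Bt J} {a' : Dy} {j' : J} {b' : Bt J}
    (h : ¬ (a = a' ∧ j = j')) : dir (ext a j b) (ext a' j' b') = lft := by
  rw [dir]; simp [h]
/-- Direction out of a branch. -/
theorem dir_ext_out {a : Dy} {j : J} {b : Bt J} {q : Bt J} (h : ∀ b', q ≠ ext a j b') :
    dir (ext a j b) q = lft := by
  cases q with
  | tip c => exact dir_ext_tip ..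
  | ext a' j' b' =>
    apply dir_ext_ne
    rintro ⟨rfl, rfl⟩
    exact h b' rfl
/-- Direction into a branch. -/
theorem dir_into {a : Dy} {j : J} {r : Bt J} (h : ∀ b', r ≠ ext a j b') (x y : Bt J) :
    dir r (ext a j x) = dir r (ext a j y) := by
  cases r with
  | tip c => rw [dir, dir]; rfl
  | ext a' j' b' =>
    have : ¬ (a' = a ∧ j' = j) := by rintro ⟨rfl, rfl⟩; exact h b' rfl
    rw [dir_ext_ne this, dir_ext_ne this]

theorem eq_or_of_hd_eq {q : Bt J} {a : Dy} (h : q.hd = a) : q = tip a ∨ ∃ j b, q = ext a j b := by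
  subst h
  cases q with
  | tip a => exact Or.inl rfl
  | ext a j b => exact Or.inr ⟨j, b, rfl⟩

theorem T0 (b r : Bt J) (h : b ≠ r) : dir b r = lft ∨ dir r b = lft := by
  induction b generalizing r with
  | tip a =>
    cases r with
    | tip c =>
      have : a ≠ c := by rintro rfl; exact h rfl
      rcases lt_or_gt_of_ne this with h | h
      · right; exact dir_tip_lt h
      · left; exact dir_tip_lt h
    | ext c k b => right; exact dir_ext_tip ..
  | ext a j b ih =>
    by_cases hr : ∃ b', r = ext a j b'
    · obtain ⟨b', rfl⟩ := hr
      rw [dir_ext_same, dir_ext_same]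
      exact ih b' (by rintro rfl; exact h rfl)
    · push Not at hr
      left; exact dir_ext_out hr

theorem tri (p q r : Bt J) (h : q ≠ r) (h1 : p ≠ q) (h2 : p ≠ r) :
    dir q p = dir q r ∨ dir r p = dir r q := by
  induction q generalizing p r with
  | tip a =>
    cases r with
    | tip c =>
      have hac : a ≠ c := by rintro rfl; exact h rfl
      rcases lt_or_gt_of_ne hac with h | h
      · by_cases hp : a < p.hd
        · left; rw [dir_tip_gt hp, dir_tip_gt]; exact h
        · push Not at hp
          right; rw [dir_tip_lt (hp.trans_lt h), dir_tip_lt]; exact h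
      · by_cases hp : p.hd < a
        · left; rw [dir_tip_lt hp, dir_tip_lt]; exact h
        · push Not at hp
          right; rw [dir_tip_gt (h.trans_le hp), dir_tip_gt]; exact h
    | ext c k b =>
      by_cases hr : ∃ b', p = ext c k b'
      · obtain ⟨b', rfl⟩ := hr
        left; exact dir_into (by simp) _ _
      · push Not at hr
        right; rw [dir_ext_out hr, dir_ext_tip]
  | ext a j b ih =>
    by_cases hr : ∃ b', r = ext a j b'
    · obtain ⟨b', rfl⟩ := hr
      by_cases hp : ∃ b', p = ext a j b'
      · obtain ⟨b'', rfl⟩ := hp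
        simp only [dir_ext_same]
        apply ih <;> rintro rfl <;> simp at *
      · push Not at hp
        rw [dir_ext_out hp, dir_ext_out hp, dir_ext_same, dir_ext_same]
        exact (T0 b b' (by rintro rfl; exact h rfl)).imp Eq.symm Eq.symm
    · push Not at hr
      by_cases hp : ∃ b', p = ext a j b'
      · obtain ⟨b'', rfl⟩ := hp
        right
        exact dir_into hr _ _
      · push Not at hp
        left
        rw [dir_ext_out hp, dir_ext_out hr]

theorem exists_below (b : Bt J) : ∃ m : Dy, dir (tip m) b = rgt ∧ b ≠ tip m := by
  obtain ⟨m, hm⟩ := exists_lt b.hd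
  exact ⟨m, dir_tip_gt hm, by rintro rfl; exact lt_irrefl _ hm⟩

theorem exists_bet (p q : Bt J) (h : p ≠ q) : ∃ r, r ≠ p ∧ r ≠ q ∧ dir r p ≠ dir r q := by
  have key : ∀ (a : Dy) (j : J) (b q : Bt J), (∀ b', q ≠ ext a j b') → ∃ r, r ≠ ext a j b ∧ r ≠ q ∧
      dir r (ext a j b) ≠ dir r q := by
    intro a j b q hq
    obtain ⟨m, hm, hm2⟩ := exists_below b
    refine ⟨ext a j (tip m), ?_, (hq _).symm, ?_⟩
    · intro h; injection h with _ _ h; exact hm2 h.symm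
    · rw [dir_ext_same, hm, dir_ext_out hq]; simp
  induction p generalizing q with
  | tip a =>
    cases q with
    | tip c =>
      have hac : a ≠ c := by rintro rfl; exact h rfl
      rcases lt_or_gt_of_ne hac with h | h
      · obtain ⟨m, h1, h2⟩ := exists_between h
        refine ⟨tip m, by simpa using h1.ne', by simpa using h2.ne, ?_⟩
        rw [dir_tip_lt h1, dir_tip_gt h2]; simp
      · obtain ⟨m, h1, h2⟩ := exists_between h
        refine ⟨tip m, by simpa using h2.ne, by simpa using h1.ne', ?_⟩
        rw [dir_tip_gt h2, dir_tip_lt h1]; simp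
    | ext c k b =>
      obtain ⟨r, h1, h2, h3⟩ := key c k b (tip a) (by simp)
      exact ⟨r, h2, h1, h3.symm⟩
  | ext a j b ih =>
    by_cases hr : ∃ b', q = ext a j b'
    · obtain ⟨b', rfl⟩ := hr
      obtain ⟨r, h1, h2, h3⟩ := ih b' (by rintro rfl; exact h rfl)
      exact ⟨ext a j r, by simpa using h1, by simpa using h2, by rwa [dir_ext_same, dir_ext_same]⟩
    · push Not at hr
      exact key a j b q hr

theorem surj (p : Bt J) (d : Dl J) : ∃ q, q ≠ p ∧ dir p q = d := by
  induction p with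
  | tip a =>
    rcases d with (_ | _) | j
    · obtain ⟨m, hm⟩ := exists_lt a
      exact ⟨tip m, by simpa using hm.ne, dir_tip_lt hm⟩
    · obtain ⟨m, hm⟩ := exists_gt a
      exact ⟨tip m, by simpa using hm.ne', dir_tip_gt hm⟩
    · exact ⟨ext a j (tip a), by simp, dir_tip_ext ..⟩
  | ext a j b ih =>
    obtain ⟨q, h1, h2⟩ := ih
    exact ⟨ext a j q, by simpa using h1, by rw [dir_ext_same, h2]⟩

/-- Betweenness. -/
def btw (m p q : Bt J) : Prop := m = p ∨ m = q ∨ dir m p ≠ dir m q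

theorem btw.symm {m p q : Bt J} (h : btw m p q) : btw m q p := by
  rcases h with h | h | h
  · exact Or.inr (Or.inl h)
  · exact Or.inl h
  · exact Or.inr (Or.inr h.symm)

/-- Same branch. -/
def SB (p q : Bt J) : Prop := ∃ a j b b', p = ext a j b ∧ q = ext a j b'

theorem SB.symm {p q : Bt J} (h : SB p q) : SB q p := by
  obtain ⟨a, j, b, b', h1, h2⟩ := h
  exact ⟨a, j, b', b, h2, h1⟩

theorem SB.trans {p q r : Bt J} (h : SB p q) (h' : SB q r) : SB p r := by
  obtain ⟨a, j, b, b', rfl, rfl⟩ := h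
  obtain ⟨a', j', c, c', h1, rfl⟩ := h'
  injection h1 with e1 e2 e3
  subst e1 e2
  exact ⟨_, _, b, c', rfl, rfl⟩

theorem btw_tip {h : Dy} {p q : Bt J} (h1 : p.hd ≤ h) (h2 : h ≤ q.hd) (hs : ¬ SB p q) :
    btw (tip h) p q := by
  rcases h1.lt_or_eq with h1 | h1
  · rcases h2.lt_or_eq with h2 | h2
    · right; right
      rw [dir_tip_lt h1, dir_tip_gt h2]; simp
    · rcases eq_or_of_hd_eq h2.symm with rfl | ⟨j, b, rfl⟩
      · exact Or.inr (Or.inl rfl)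
      · right; right
        rw [dir_tip_lt h1, dir_tip_ext]; simp
  · rcases eq_or_of_hd_eq h1 with rfl | ⟨j, b, rfl⟩
    · exact Or.inl rfl
    · rcases h2.lt_or_eq with h2 | h2
      · right; right
        rw [dir_tip_gt h2, dir_tip_ext]; simp
      · rcases eq_or_of_hd_eq h2.symm with rfl | ⟨k, c, rfl⟩
        · exact Or.inr (Or.inl rfl)
        · right; right
          rw [dir_tip_ext, dir_tip_ext]
          intro h
          injection h with h
          subst h
          exact hs ⟨_, _, _, _, rfl, rfl⟩

theorem btw_ext {a : Dy} {j : J} {m p q : Bt J} (h : btw m p q) :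
    btw (ext a j m) (ext a j p) (ext a j q) := by
  rcases h with rfl | rfl | h
  · exact Or.inl rfl
  · exact Or.inr (Or.inl rfl)
  · right; right; rwa [dir_ext_same, dir_ext_same]

theorem root_tip {h : Dy} {q : Bt J} (h2 : h ≤ q.hd) : tip h = q ∨ dir (tip h) q ≠ lft := by
  rcases h2.lt_or_eq with h2 | h2
  · right; rw [dir_tip_gt h2]; simp
  · rcases eq_or_of_hd_eq h2.symm with rfl | ⟨j, b, rfl⟩
    · exact Or.inl rfl
    · right; rw [dir_tip_ext]; simp

theorem meet (p q : Bt J) : ∃ m, btw m p q ∧ (m = p ∨ dir m p ≠ lft) ∧ (m = q ∨ dir m q ≠ lft) := by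
  have key : ∀ p q : Bt J, ¬ SB p q →
      ∃ m, btw m p q ∧ (m = p ∨ dir m p ≠ lft) ∧ (m = q ∨ dir m q ≠ lft) := by
    intro p q hs
    refine ⟨tip (min p.hd q.hd), ?_, root_tip (min_le_left _ _), root_tip (min_le_right _ _)⟩
    rcases le_total p.hd q.hd with h | h
    · exact btw_tip (by rw [min_eq_left h]) (min_le_right _ _) hs
    · exact (btw_tip (by rw [min_eq_right h]) (min_le_left _ _) (fun h => hs h.symm)).symm
  induction p generalizing q with
  | tip a => exact key _ _ (by rintro ⟨_, _, _, _, h, _⟩; simp at h)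
  | ext a j b ih =>
    by_cases hs : SB (ext a j b) q
    · obtain ⟨a', j', c, c', h1, rfl⟩ := hs
      injection h1 with e1 e2 e3
      subst e1 e2
      obtain ⟨m, h1, h2, h3⟩ := ih c'
      refine ⟨ext a j m, btw_ext h1, h2.imp ?_ ?_, h3.imp ?_ ?_⟩
      · rintro rfl; rfl
      · intro h; rwa [dir_ext_same]
      · rintro rfl; rfl
      · intro h; rwa [dir_ext_same]
    · exact key _ _ hs

/-- Median property. -/
def Med (p q r : Bt J) : Prop := ∃ m, btw m p q ∧ btw m q r ∧ btw m p r

theorem Med.perm1 {p q r : Bt J} (h : Med p q r) : Med q p r := by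
  obtain ⟨m, h1, h2, h3⟩ := h
  exact ⟨m, h1.symm, h3, h2⟩

theorem Med.perm2 {p q r : Bt J} (h : Med p q r) : Med p r q := by
  obtain ⟨m, h1, h2, h3⟩ := h
  exact ⟨m, h3, h2.symm, h1⟩

theorem med_two (p q r : Bt J) (h : SB p q) (h' : ¬ SB p r) : Med p q r := by
  obtain ⟨a, j, b, b', rfl, rfl⟩ := h
  have hr : ∀ c, r ≠ ext a j c := by
    rintro c rfl; exact h' ⟨_, _, _, _, rfl, rfl⟩
  obtain ⟨m, h1, h2, h3⟩ := meet b b'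
  have key : ∀ b, (m = b ∨ dir m b ≠ lft) → btw (ext a j m) (ext a j b) r := by
    rintro b (rfl | h)
    · exact Or.inl rfl
    · right; right; rwa [dir_ext_same, dir_ext_out hr]
  exact ⟨ext a j m, btw_ext h1, key _ h3, key _ h2⟩

theorem med_tip (p q r : Bt J) (h1 : ¬ SB p q) (h2 : ¬ SB q r) (h3 : ¬ SB p r)
    (hpq : p.hd ≤ q.hd) (hqr : q.hd ≤ r.hd) : Med p q r :=
  ⟨tip q.hd, btw_tip hpq le_rfl h1, btw_tip le_rfl hqr h2, btw_tip hpq hqr h3⟩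

theorem med_none (p q r : Bt J) (h1 : ¬ SB p q) (h2 : ¬ SB q r) (h3 : ¬ SB p r) : Med p q r := by
  have h1' : ¬ SB q p := fun h => h1 h.symm
  have h2' : ¬ SB r q := fun h => h2 h.symm
  have h3' : ¬ SB r p := fun h => h3 h.symm
  rcases le_total p.hd q.hd with a | a <;> rcases le_total q.hd r.hd with b | b <;>
    rcases le_total p.hd r.hd with c | c
  · exact med_tip p q r h1 h2 h3 a b
  · exact med_tip p q r h1 h2 h3 a b
  · exact (med_tip p r q h3 h2' h1 c b).perm2
  · exact (med_tip r p q h3' h1 h2' c a).perm1.perm2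
  · exact (med_tip q p r h1' h3 h2 a c).perm1
  · exact (med_tip q r p h2 h3' h1' b c).perm2.perm1
  · exact (med_tip r q p h2' h1' h3' b a).perm1.perm2.perm1
  · exact (med_tip r q p h2' h1' h3' b a).perm1.perm2.perm1

theorem med (p q r : Bt J) : Med p q r := by
  induction p generalizing q r with
  | tip a =>
    have h : ∀ q : Bt J, ¬ SB (tip a) q := by rintro q ⟨_, _, _, _, h, _⟩; simp at h
    by_cases h2 : SB q r
    · exact (med_two q r (tip a) h2 (fun h' => h q h'.symm)).perm2.perm1
    · exact med_none _ _ _ (h _) h2 (h _)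
  | ext a j b ih =>
    by_cases h1 : SB (ext a j b) q
    · by_cases h2 : SB (ext a j b) r
      · obtain ⟨a', j', c, c', e, rfl⟩ := h1
        injection e with e1 e2 e3
        subst e1 e2
        obtain ⟨a', j', d, d', e, rfl⟩ := h2
        injection e with e1 e2 e3
        subst e1 e2
        obtain ⟨m, m1, m2, m3⟩ := ih c' d'
        exact ⟨ext a j m, btw_ext m1, btw_ext m2, btw_ext m3⟩
      · exact med_two _ _ _ h1 h2
    · by_cases h2 : SB (ext a j b) r
      · exact (med_two _ _ _ h2 h1).perm2
      · by_cases h3 : SB q r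
        · exact (med_two q r _ h3 (fun h' => h1 h'.symm)).perm2.perm1
        · exact med_none _ _ _ h1 h3 h2

/-- The concrete structure. -/
noncomputable def tree (J : Type) : DTree (Bt J) (Dl J) where
  dir := dir
  tri := tri
  dense := exists_bet
  surj := surj
  med := med

theorem tree_dir (p q : Bt J) : (tree J).dir p q = dir p q := rfl

instance [Countable J] : Countable (Bt J) := by
  let f : Bt J → List (Dy × Option J) := fun b => Bt.rec (fun a => [(a, none)])
    (fun a j _ l => (a, some j) :: l) b
  apply Function.Injective.countable (f := f)
  intro b
  induction b with
  | tip a =>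
    intro c h
    cases c with
    | tip a' => simpa [f] using h
    | ext a' j' b' => simp [f] at h
  | ext a j b ih =>
    intro c h
    cases c with
    | tip a' => simp [f] at h
    | ext a' j' b' =>
      simp only [f, List.cons.injEq, Prod.mk.injEq, Option.some.injEq] at h
      obtain ⟨⟨rfl, rfl⟩, h⟩ := h
      rw [ih h]

instance : Nonempty (Bt J) := ⟨tip 0⟩

end Bt

namespace Bt

variable {J : Type}

/-- Change the head. -/
def mapHd (u : Dy → Dy) : Bt J → Bt J
  | tip a => tip (u a)
  | ext a j b => ext (u a) j b

theorem hd_mapHd (u : Dy → Dy) (p : Bt J) : (mapHd u p).hd = u p.hd := by cases p <;> rfl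

theorem mapHd_inj {u : Dy → Dy} (hu : Function.Injective u) :
    Function.Injective (mapHd u : Bt J → Bt J) := by
  intro p q h
  cases p <;> cases q <;> simp [mapHd] at h
  · rw [hu h]
  · obtain ⟨h1, h2, h3⟩ := h
    rw [hu h1, h2, h3]

theorem dir_mapHd {u : Dy → Dy} (hu : StrictMono u) (p q : Bt J) :
    dir (mapHd u p) (mapHd u q) = dir p q := by
  cases p with
  | tip a =>
    rw [mapHd, dir, dir, hd_mapHd]
    simp only [hu.lt_iff_lt]
    congr 2
    cases q <;> rfl
  | ext a j b =>
    cases q with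
    | tip c => simp only [mapHd, dir_ext_tip]
    | ext c k d =>
      simp only [mapHd]
      by_cases hh : a = c ∧ j = k
      · obtain ⟨rfl, rfl⟩ := hh
        rw [dir_ext_same, dir_ext_same]
      · rw [dir_ext_ne hh, dir_ext_ne]
        rwa [hu.injective.eq_iff]

/-- Swap left and right. -/
def sw : Dl J → Dl J
  | Sum.inl b => Sum.inl (!b)
  | Sum.inr j => Sum.inr j

theorem sw_inj : Function.Injective (sw : Dl J → Dl J) := by
  intro a b h
  rcases a with a | a <;> rcases b with b | b <;> simp [sw] at h ⊢ <;> exact h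

/-- Local change of directions. -/
def loc (d : Dl J) (b : Bt J) : Dl J → Dl J := match d, b with
  | Sum.inl false, tip _ => sw
  | _, _ => id

theorem loc_inj (d : Dl J) (b : Bt J) : Function.Injective (loc d b) := by
  rcases d with (_ | _) | j <;> cases b <;> simp only [loc] <;>
    first | exact sw_inj | exact Function.injective_id

theorem dir_mapHd_anti {u : Dy → Dy} (hu : StrictAnti u) (p q : Bt J) (hpq : q ≠ p) :
    dir (mapHd u p) (mapHd u q) = loc lft p (dir p q) := by
  cases p with
  | tip a =>
    change dir (tip (u a)) (mapHd u q) = sw (dir (tip a) q)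
    rcases lt_trichotomy q.hd a with h | h | h
    · rw [dir_tip_lt h, dir_tip_gt]
      · rfl
      · rw [hd_mapHd]; exact hu h
    · rcases eq_or_of_hd_eq h with rfl | ⟨j, b, rfl⟩
      · exact absurd rfl hpq
      · rw [mapHd, dir_tip_ext, dir_tip_ext]; rfl
    · rw [dir_tip_gt h, dir_tip_lt]
      · rfl
      · rw [hd_mapHd]; exact hu h
  | ext a j b =>
    simp only [loc, id]
    cases q with
    | tip c => simp only [mapHd, dir_ext_tip]
    | ext c k d =>
      simp only [mapHd]
      by_cases hh : a = c ∧ j = k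
      · obtain ⟨rfl, rfl⟩ := hh
        rw [dir_ext_same, dir_ext_same]
      · rw [dir_ext_ne hh, dir_ext_ne]
        rwa [hu.injective.eq_iff]

theorem exists_u : ∃ u : Dy → Dy, StrictMono u ∧ ∀ x, 0 < x ↔ ∃ y, u y = x := by
  obtain ⟨e⟩ := Order.iso_of_countable_dense Dy (Set.Ioi (0 : Dy))
  refine ⟨fun x => (e x).1, fun a b h => e.strictMono h, fun x => ⟨fun h => ⟨e.symm ⟨x, h⟩, by simp⟩, ?_⟩⟩
  rintro ⟨y, rfl⟩
  exact (e y).2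

/-- Chart of the positive ray. -/
noncomputable def uu : Dy → Dy := exists_u.choose
theorem uu_mono : StrictMono uu := exists_u.choose_spec.1
theorem uu_iff (x : Dy) : 0 < x ↔ ∃ y, uu y = x := exists_u.choose_spec.2 x
theorem uu_pos (x : Dy) : 0 < uu x := (uu_iff _).2 ⟨x, rfl⟩

/-- Chart of the negative ray. -/
noncomputable def vv (x : Dy) : Dy := - uu x
theorem vv_anti : StrictAnti vv := fun _ _ h => neg_lt_neg (uu_mono h)
theorem vv_neg (x : Dy) : vv x < 0 := neg_lt_zero.2 (uu_pos x)
theorem vv_iff (x : Dy) : x < 0 ↔ ∃ y, vv y = x := by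
  rw [← neg_pos, uu_iff]
  simp only [vv, neg_eq_iff_eq_neg]

/-- Charts at the base point. -/
noncomputable def psi : Dl J → Bt J → Bt J
  | Sum.inl true => mapHd uu
  | Sum.inl false => mapHd vv
  | Sum.inr j => ext 0 j

theorem dir_base_psi (d : Dl J) (b : Bt J) : dir (tip 0) (psi d b) = d := by
  rcases d with (_ | _) | j
  · exact dir_tip_lt (by simp only [psi, hd_mapHd]; exact vv_neg _)
  · exact dir_tip_gt (by simp only [psi, hd_mapHd]; exact uu_pos _)
  · exact dir_tip_ext ..

theorem psi_ne (d : Dl J) (b : Bt J) : psi d b ≠ tip 0 := by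
  rcases d with (_ | _) | j
  · intro h
    have : (mapHd vv b).hd = 0 := congrArg hd h
    rw [hd_mapHd] at this
    exact (vv_neg _).ne this
  · intro h
    have : (mapHd uu b).hd = 0 := congrArg hd h
    rw [hd_mapHd] at this
    exact (uu_pos _).ne' this
  · simp [psi]

theorem psi_inj (d : Dl J) : Function.Injective (psi d) := by
  rcases d with (_ | _) | j
  · exact mapHd_inj vv_anti.injective
  · exact mapHd_inj uu_mono.injective
  · intro a b h; simpa [psi] using h

theorem mapHd_surj {u : Dy → Dy} {p : Bt J} (h : ∃ y, u y = p.hd) : ∃ b, mapHd u b = p := by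
  obtain ⟨y, hy⟩ := h
  cases p with
  | tip a => exact ⟨tip y, by rw [mapHd, hy]; rfl⟩
  | ext a j b => exact ⟨ext y j b, by rw [mapHd, hy]; rfl⟩

theorem psi_surj' (p : Bt J) (hp : p ≠ tip 0) : ∃ b, psi (dir (tip 0) p) b = p := by
  rcases lt_trichotomy p.hd 0 with h | h | h
  · rw [dir_tip_lt h]
    exact mapHd_surj ((vv_iff _).1 h)
  · rcases eq_or_of_hd_eq h with rfl | ⟨j, b, rfl⟩
    · exact absurd rfl hp
    · rw [dir_tip_ext]
      exact ⟨b, rfl⟩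
  · rw [dir_tip_gt h]
    exact mapHd_surj ((uu_iff _).1 h)

theorem psi_surj (p : Bt J) (hp : p ≠ tip 0) : ∃ d b, psi d b = p := ⟨_, psi_surj' p hp⟩

theorem dir_psi_same (d : Dl J) (b b' : Bt J) (h : b' ≠ b) :
    dir (psi d b) (psi d b') = loc d b (dir b b') := by
  rcases d with (_ | _) | j
  · exact dir_mapHd_anti vv_anti b b' h
  · simp only [psi, loc, id]
    exact dir_mapHd uu_mono b b'
  · simp only [psi, loc, id]
    exact dir_ext_same ..

theorem dir_psi_out (d : Dl J) (b q : Bt J) (h : ∀ b', q ≠ psi d b') :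
    dir (psi d b) q = loc d b lft := by
  rcases d with (_ | _) | j
  · have hq : ¬ q.hd < 0 := by
      intro hq
      obtain ⟨b', hb'⟩ := mapHd_surj ((vv_iff _).1 hq)
      exact h b' hb'.symm
    push Not at hq
    cases b with
    | tip a =>
      simp only [psi, mapHd, loc]
      rw [dir_tip_gt ((vv_neg a).trans_le hq)]; rfl
    | ext a j b =>
      simp only [psi, mapHd, loc]
      rw [dir_ext_out]; · rfl
      rintro b' rfl
      exact absurd (vv_neg a) (not_lt.2 hq)
  · have hq : ¬ 0 < q.hd := by
      intro hq
      obtain ⟨b', hb'⟩ := mapHd_surj ((uu_iff _).1 hq)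
      exact h b' hb'.symm
    push Not at hq
    cases b with
    | tip a =>
      simp only [psi, mapHd, loc]
      rw [dir_tip_lt (hq.trans_lt (uu_pos a))]; rfl
    | ext a j b =>
      simp only [psi, mapHd, loc]
      rw [dir_ext_out]; · rfl
      rintro b' rfl
      exact absurd (uu_pos a) (not_lt.2 hq)
  · simp only [psi, loc, id]
    exact dir_ext_out h

/-- Global chart. -/
noncomputable def chart : Option (Dl J × Bt J) ≃ Bt J :=
  Equiv.ofBijective (fun o => match o with
    | none => tip 0
    | some x => psi x.1 x.2) (by
    constructor
    · intro o o' h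
      rcases o with _ | ⟨d, b⟩ <;> rcases o' with _ | ⟨d', b'⟩
      · rfl
      · exact absurd h.symm (psi_ne _ _)
      · exact absurd h (psi_ne _ _)
      · have h' : psi d b = psi d' b' := h
        have h1 := dir_base_psi d b
        rw [h', dir_base_psi] at h1
        subst h1
        rw [psi_inj _ h']
    · intro p
      by_cases hp : p = tip 0
      · exact ⟨none, hp.symm⟩
      · obtain ⟨d, b, h⟩ := psi_surj p hp
        exact ⟨some (d, b), h⟩)

theorem chart_none : (chart none : Bt J) = tip 0 := rfl
theorem chart_some (d : Dl J) (b : Bt J) : chart (some (d, b)) = psi d b := rfl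

/-- Action of permutations of directions at the base point. -/
noncomputable def sB : Equiv.Perm (Dl J) →* Equiv.Perm (Bt J) where
  toFun s := chart.symm.trans ((Equiv.optionCongr (s.prodCongr (Equiv.refl _))).trans chart)
  map_one' := by
    ext p
    obtain ⟨o, rfl⟩ := chart.surjective p
    rcases o with _ | ⟨d, b⟩ <;> simp
  map_mul' := by
    intro s t
    ext p
    obtain ⟨o, rfl⟩ := chart.surjective p
    rcases o with _ | ⟨d, b⟩ <;> simp

theorem sB_base (s : Equiv.Perm (Dl J)) : sB s (tip 0) = tip 0 := by
  rw [← chart_none]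
  simp [sB]

theorem sB_psi (s : Equiv.Perm (Dl J)) (d : Dl J) (b : Bt J) : sB s (psi d b) = psi (s d) b := by
  rw [← chart_some, ← chart_some]
  simp [sB]

/-- Action of order automorphisms. -/
def fB : (Dy ≃o Dy) →* Equiv.Perm (Bt J) where
  toFun f := ⟨mapHd f, mapHd f.symm, fun p => by cases p <;> simp [mapHd],
    fun p => by cases p <;> simp [mapHd]⟩
  map_one' := by ext p; cases p <;> rfl
  map_mul' := by intro f g; ext p; cases p <;> rfl

theorem fB_apply (f : Dy ≃o Dy) (p : Bt J) : fB f p = mapHd f p := rfl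
theorem fB_tip (f : Dy ≃o Dy) (a : Dy) : (fB f (tip a) : Bt J) = tip (f a) := rfl
theorem fB_ext (f : Dy ≃o Dy) (a : Dy) (j : J) (b : Bt J) : fB f (ext a j b) = ext (f a) j b := rfl

theorem dir_fB (f : Dy ≃o Dy) (p q : Bt J) : dir (fB f p) (fB f q) = dir p q :=
  dir_mapHd f.strictMono p q

theorem fB_Aut (f : Dy ≃o Dy) : fB f ∈ (tree J).Aut := by
  intro p q r _ _
  simp only [tree_dir, dir_fB]

theorem sB_Aut (s : Equiv.Perm (Dl J)) : sB s ∈ (tree J).Aut := by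
  intro p q r hq hr
  simp only [tree_dir]
  by_cases hp : p = tip 0
  · subst hp
    obtain ⟨d, b, rfl⟩ := psi_surj q hq
    obtain ⟨e, c, rfl⟩ := psi_surj r hr
    simp only [sB_psi, sB_base, dir_base_psi, s.injective.eq_iff]
  · obtain ⟨d, b, rfl⟩ := psi_surj p hp
    have key : ∀ q, q ≠ psi d b → ∃ e, dir (psi d b) q = loc d b e ∧
        dir (sB s (psi d b)) (sB s q) = loc (s d) b e := by
      intro q hq
      by_cases h : ∃ b', q = psi d b'
      · obtain ⟨b', rfl⟩ := h
        have hb : b' ≠ b := by rintro rfl; exact hq rfl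
        refine ⟨dir b b', dir_psi_same d b b' hb, ?_⟩
        rw [sB_psi, sB_psi, dir_psi_same _ _ _ hb]
      · push Not at h
        refine ⟨lft, dir_psi_out d b q h, ?_⟩
        rw [sB_psi]
        apply dir_psi_out
        intro b' hb'
        rw [← sB_psi] at hb'
        exact h b' ((sB s).injective hb')
    obtain ⟨e, h1, h2⟩ := key q hq
    obtain ⟨e', h3, h4⟩ := key r hr
    rw [h1, h2, h3, h4, (loc_inj _ _).eq_iff, (loc_inj _ _).eq_iff]

/-- Generators of the group. -/
def gensB (J : Type) : Set (Equiv.Perm (Bt J)) := (fB '' Dy.gens) ∪ Set.range sB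

/-- The group. -/
def Ga (J : Type) : Subgroup (Equiv.Perm (Bt J)) := Subgroup.closure (gensB J)

theorem Ga_le : Ga J ≤ (tree J).Aut := by
  rw [Ga, Subgroup.closure_le]
  rintro _ (⟨f, _, rfl⟩ | ⟨s, rfl⟩)
  · exact fB_Aut f
  · exact sB_Aut s

theorem sB_mem (s : Equiv.Perm (Dl J)) : sB s ∈ Ga J :=
  Subgroup.subset_closure (Or.inr ⟨s, rfl⟩)

theorem fB_mem {f : Dy ≃o Dy} (hf : f ∈ Dy.F) : fB f ∈ Ga J := by
  have : Dy.F ≤ (Ga J).comap fB := by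
    rw [Dy.F, Subgroup.closure_le]
    intro f hf
    exact Subgroup.subset_closure (Or.inl ⟨f, hf, rfl⟩)
  exact this hf

theorem gensB_finite [Finite J] : (gensB J).Finite :=
  ((show Dy.gens.Finite from by rw [Dy.gens]; exact Set.toFinite _).image _).union (Set.finite_range _)

theorem Ga_fg [Finite J] : (Ga J).FG :=
  (Subgroup.fg_iff _).2 ⟨gensB J, rfl, gensB_finite⟩

/-- Grafting. -/
def plus : Bt J → J → Bt J → Bt J
  | tip a, j, b => ext a j b
  | ext a k c, j, b => ext a k (plus c j b)

theorem plus_ne (p : Bt J) (j : J) (b : Bt J) : plus p j b ≠ p := by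
  induction p with
  | tip a => simp [plus]
  | ext a k c ih => simpa [plus] using ih

theorem dir_plus (p : Bt J) (j : J) (b : Bt J) : dir p (plus p j b) = Sum.inr j := by
  induction p with
  | tip a => exact dir_tip_ext ..
  | ext a k c ih => rw [plus, dir_ext_same, ih]

theorem eq_plus (p q : Bt J) (j : J) (h : dir p q = Sum.inr j) : ∃ b, q = plus p j b := by
  induction p generalizing q with
  | tip a =>
    rcases lt_trichotomy q.hd a with h' | h' | h'
    · rw [dir_tip_lt h'] at h; simp at h
    · rcases eq_or_of_hd_eq h' with rfl | ⟨k, b, rfl⟩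
      · simp [dir, off, hd] at h
      · rw [dir_tip_ext] at h
        injection h with h
        subst h
        exact ⟨b, rfl⟩
    · rw [dir_tip_gt h'] at h; simp at h
  | ext a k c ih =>
    by_cases hq : ∃ b', q = ext a k b'
    · obtain ⟨b', rfl⟩ := hq
      rw [dir_ext_same] at h
      obtain ⟨b, rfl⟩ := ih b' h
      exact ⟨b, rfl⟩
    · push Not at hq
      rw [dir_ext_out hq] at h; simp at h

theorem finite_off (p : Bt J) : {y : Bt J | ∃ j, dir y p = Sum.inr j}.Finite := by
  induction p with
  | tip a =>
    apply Set.Finite.subset Set.finite_empty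
    rintro y ⟨j, h⟩
    obtain ⟨b, hb⟩ := eq_plus _ _ _ h
    cases y <;> simp [plus] at hb
  | ext a k c ih =>
    refine ((ih.image (ext a k)).insert (tip a)).subset ?_
    rintro y ⟨j, h⟩
    obtain ⟨b, hb⟩ := eq_plus _ _ _ h
    cases y with
    | tip a' =>
      simp only [plus, ext.injEq] at hb
      left; rw [hb.1]
    | ext a' k' c' =>
      simp only [plus, ext.injEq] at hb
      obtain ⟨rfl, rfl, hb⟩ := hb
      rw [dir_ext_same] at h
      exact Or.inr ⟨c', ⟨j, h⟩, rfl⟩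

/-- Exceptional points of a permutation. -/
def bad (g : Equiv.Perm (Bt J)) : Set (Bt J) := {p | ∃ j b, g (plus p j b) ≠ plus (g p) j b}

theorem plus_mapHd (u : Dy → Dy) (p : Bt J) (j : J) (b : Bt J) :
    mapHd u (plus p j b) = plus (mapHd u p) j b := by cases p <;> rfl

theorem plus_psi (d : Dl J) (p : Bt J) (j : J) (b : Bt J) :
    psi d (plus p j b) = plus (psi d p) j b := by
  rcases d with (_ | _) | k
  · exact plus_mapHd ..
  · exact plus_mapHd ..
  · rfl

theorem bad_finite {g : Equiv.Perm (Bt J)} (hg : g ∈ Ga J) : (bad g).Finite := by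
  induction hg using Subgroup.closure_induction with
  | mem g hg =>
    rcases hg with ⟨f, _, rfl⟩ | ⟨s, rfl⟩
    · apply Set.Finite.subset Set.finite_empty
      rintro p ⟨j, b, h⟩
      exact absurd (plus_mapHd _ _ _ _) h
    · apply Set.Finite.subset (Set.finite_singleton (tip 0))
      rintro p ⟨j, b, h⟩
      by_contra hp
      obtain ⟨d, c, rfl⟩ := psi_surj p hp
      apply h
      rw [← plus_psi, sB_psi, sB_psi, plus_psi]
  | one =>
    apply Set.Finite.subset Set.finite_empty
    rintro p ⟨j, b, h⟩
    exact absurd rfl h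
  | mul f g _ _ hf hg =>
    apply (hg.union (hf.image (g⁻¹ : Equiv.Perm (Bt J)))).subset
    rintro p ⟨j, b, h⟩
    by_cases hp : p ∈ bad g
    · exact Or.inl hp
    · right
      refine ⟨g p, ⟨j, b, ?_⟩, perm_ia g p⟩
      intro hcon
      apply h
      have : g (plus p j b) = plus (g p) j b := by
        by_contra hh; exact hp ⟨j, b, hh⟩
      rw [Equiv.Perm.mul_apply, this, hcon]
      rfl
  | inv f _ hf =>
    apply (hf.image f).subset
    rintro p ⟨j, b, h⟩
    refine ⟨f⁻¹ p, ⟨j, b, ?_⟩, perm_ai f p⟩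
    intro hcon
    apply h
    apply f.injective
    rw [hcon, perm_ai, perm_ai]

end Bt

namespace DTree

variable {B Δ : Type} (T : DTree B Δ)

/-- Strict betweenness. -/
def Bet (m p q : B) : Prop := m ≠ p ∧ m ≠ q ∧ T.dir m p ≠ T.dir m q

theorem gate (x : B) (E : Finset B) (hE : E.Nonempty) : ∃ m, (m ∈ E ∨ ∃ e ∈ E, ∃ e' ∈ E, T.Bet m e e') ∧
    (m = x ∨ ∀ e ∈ E, e ≠ m → T.dir m e ≠ T.dir m x) := by
  classical
  induction hE using Finset.Nonempty.cons_induction with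
  | singleton e =>
    refine ⟨e, Or.inl (by simp), Or.inr ?_⟩
    intro e' he' h
    exact absurd (by simpa using he') h
  | cons e E' h hE' ih =>
    simp only [Finset.cons_eq_insert]
    obtain ⟨m, hm, hmx⟩ := ih
    have hm' : m ∈ insert e E' ∨ ∃ e1 ∈ insert e E', ∃ e2 ∈ insert e E', T.Bet m e1 e2 := by
      rcases hm with hm | ⟨e1, h1, e2, h2, h3⟩
      · exact Or.inl (Finset.mem_insert_of_mem hm)
      · exact Or.inr ⟨e1, Finset.mem_insert_of_mem h1, e2, Finset.mem_insert_of_mem h2, h3⟩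
    rcases hmx with rfl | hmx
    · exact ⟨m, hm', Or.inl rfl⟩
    by_cases hx : m = x
    · exact ⟨m, hm', Or.inl hx⟩
    by_cases hem : e ≠ m → T.dir m e ≠ T.dir m x
    · refine ⟨m, hm', Or.inr ?_⟩
      intro e' he'
      rcases Finset.mem_insert.1 he' with rfl | he'
      · exact hem
      · exact hmx e' he'
    push Not at hem
    obtain ⟨hem, hdir⟩ := hem
    obtain ⟨w, w1, w2, w3⟩ := T.med m e x
    have hwm : w ≠ m := by
      rintro rfl
      rcases w2 with h | h | h
      · exact hem h.symm
      · exact hx h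
      · exact h hdir
    have hmw : T.dir m w = T.dir m x := by
      rcases w1 with h | h | h
      · exact absurd h hwm
      · rw [h, hdir]
      · by_cases hwe : w = e
        · rw [hwe, hdir]
        · rw [← hdir]; exact (T.sepd hwm hwe h.symm).symm
    refine ⟨w, ?_, ?_⟩
    · by_cases hwe : w = e
      · left; rw [hwe]; simp
      · right
        have hbet : T.dir w m ≠ T.dir w e := by
          rcases w1 with h | h | h
          · exact absurd h hwm
          · exact absurd h hwe
          · exact h
        have key : ∀ e1 ∈ E', e1 ≠ m → T.dir m e1 ≠ T.dir m e → T.Bet w e1 e := by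
          intro e1 _ h1 h2
          have hwe1 : w ≠ e1 := by
            rintro rfl
            exact h2 (hmw.trans hdir.symm)
          refine ⟨hwe1, hwe, ?_⟩
          rwa [T.sepd (m := m) (p := e1) (q := w) hwm.symm h1.symm (by rw [hmw, ← hdir]; exact h2)]
        rcases hm with hm | ⟨e1, h1, e2, h2, h3, h4, h5⟩
        · exact ⟨m, Finset.mem_insert_of_mem hm, e, Finset.mem_insert_self _ _, hwm, hwe, hbet⟩
        · by_cases hh : T.dir m e1 = T.dir m e
          · exact ⟨e2, Finset.mem_insert_of_mem h2, e, Finset.mem_insert_self _ _,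
              key e2 h2 h4.symm (by rw [← hh]; exact h5.symm)⟩
          · exact ⟨e1, Finset.mem_insert_of_mem h1, e, Finset.mem_insert_self _ _,
              key e1 h1 h3.symm hh⟩
    · by_cases hwx : w = x
      · exact Or.inl hwx
      right
      have hbet : T.dir w m ≠ T.dir w x := by
        rcases w3 with h | h | h
        · exact absurd h hwm
        · exact absurd h hwx
        · exact h
      intro e' he' hne
      rcases Finset.mem_insert.1 he' with rfl | he'
      · rcases w2 with h | h | h
        · exact absurd h.symm hne
        · exact absurd h hwx
        · exact h
      · by_cases h : e' = m
        · rw [h]; exact hbet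
        · rwa [T.sepd (m := m) (p := e') (q := w) hwm.symm (Ne.symm h)
            (by rw [hmw]; exact hmx e' he' h)]

end DTree

namespace Bt

variable {J : Type}

/-- Depth. -/
def dep : Bt J → ℕ
  | tip _ => 0
  | ext _ _ b => dep b + 1

theorem dep_mapHd (u : Dy → Dy) (b : Bt J) : (mapHd u b).dep = b.dep := by cases b <;> rfl

theorem dir_sB (s : Equiv.Perm (Dl J)) {q : Bt J} (h : q ≠ tip 0) :
    dir (tip 0) (sB s q) = s (dir (tip 0) q) := by
  obtain ⟨d, b, rfl⟩ := psi_surj q h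
  rw [sB_psi, dir_base_psi, dir_base_psi]

theorem sB_fix {s : Equiv.Perm (Dl J)} {q : Bt J} (h : s (dir (tip 0) q) = dir (tip 0) q) :
    sB s q = q := by
  by_cases hq : q = tip 0
  · rw [hq, sB_base]
  · obtain ⟨b, hb⟩ := psi_surj' q hq
    conv_lhs => rw [← hb, sB_psi, h, hb]

theorem to_one (n : ℕ) (x : Bt J) (hn : x.dep = n) (hx : 0 < x.hd) :
    ∃ γ ∈ Ga J, (∀ z, z.hd ≤ 0 → γ z = z) ∧ γ x = tip Dy.one := by
  classical
  induction n using Nat.strong_induction_on generalizing x with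
  | _ n ih =>
    cases x with
    | tip a =>
      obtain ⟨f, hf, hf0, hfa⟩ := Dy.F_local 0 a Dy.one hx Dy.one_pos
      refine ⟨fB f, fB_mem hf, ?_, by rw [fB_tip, hfa]⟩
      intro z hz
      cases z with
      | tip c => rw [fB_tip, hf0 c hz]
      | ext c k b => rw [fB_ext, hf0 c hz]
    | ext a j b =>
      obtain ⟨f, hf, hf0, hfa⟩ := Dy.F_local 0 a Dy.one hx Dy.one_pos
      obtain ⟨t, ht, ht0⟩ := Dy.F_trans 0 Dy.one
      set σ : Equiv.Perm (Dl J) := Equiv.swap rgt (Sum.inr j) with hσ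
      set y : Bt J := fB t (psi rgt b) with hy
      have hyd : y.dep = b.dep := by
        rw [hy, fB_apply, dep_mapHd]; exact dep_mapHd _ _
      have hyh : 0 < y.hd := by
        rw [hy, fB_apply, hd_mapHd]
        refine Dy.one_pos.trans ?_
        rw [← ht0]
        apply t.strictMono
        change 0 < (mapHd uu b).hd
        rw [hd_mapHd]; exact uu_pos _
      obtain ⟨γ, hγ, hγ0, hγy⟩ := ih b.dep (by rw [← hn]; simp [dep]) y hyd hyh
      refine ⟨γ * (fB t * sB σ * (fB t)⁻¹) * fB f, ?_, ?_, ?_⟩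
      · exact mul_mem (mul_mem hγ (mul_mem (mul_mem (fB_mem ht) (sB_mem σ)) (inv_mem (fB_mem ht))))
          (fB_mem hf)
      · intro z hz
        have h1 : fB f z = z := by
          cases z with
          | tip c => rw [fB_tip, hf0 c hz]
          | ext c k b => rw [fB_ext, hf0 c hz]
        have h2 : sB σ ((fB t)⁻¹ z) = (fB t)⁻¹ z := by
          apply sB_fix
          have : dir (tip 0) ((fB t)⁻¹ z) = lft := by
            apply dir_tip_lt
            rw [← map_inv, fB_apply, hd_mapHd]
            apply t.strictMono.lt_iff_lt.1
            rw [ht0]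
            refine lt_of_le_of_lt ?_ Dy.one_pos
            refine le_of_eq_of_le ?_ hz
            exact t.apply_symm_apply _
          rw [this, hσ]
          exact Equiv.swap_apply_of_ne_of_ne (by simp) (by simp)
        simp only [Equiv.Perm.mul_apply]
        rw [h1, h2, perm_ai, hγ0 z hz]
      · have h1 : fB f (ext a j b) = fB t (psi (Sum.inr j) b) := by
          rw [fB_ext, hfa]
          change _ = fB t (ext 0 j b)
          rw [fB_ext, ht0]
        simp only [Equiv.Perm.mul_apply]
        rw [h1, perm_ia, sB_psi, hσ, Equiv.swap_apply_right, ← hy, hγy]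

theorem lemR {x y : Bt J} (hx : 0 < x.hd) (hy : 0 < y.hd) :
    ∃ γ ∈ Ga J, (∀ z, z.hd ≤ 0 → γ z = z) ∧ γ x = y := by
  obtain ⟨γ, h1, h2, h3⟩ := to_one _ x rfl hx
  obtain ⟨γ', h1', h2', h3'⟩ := to_one _ y rfl hy
  refine ⟨γ'⁻¹ * γ, mul_mem (inv_mem h1') h1, ?_, ?_⟩
  · intro z hz
    rw [Equiv.Perm.mul_apply, h2 z hz]
    conv_lhs => rw [← h2' z hz, perm_ia]
  · rw [Equiv.Perm.mul_apply, h3, ← h3', perm_ia]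

theorem dir_eq_rgt {q : Bt J} {a : Dy} : dir (tip a) q = rgt ↔ a < q.hd := by
  refine ⟨fun h => ?_, dir_tip_gt⟩
  by_contra hc
  rcases lt_or_eq_of_le (not_lt.1 hc) with h' | h'
  · rw [dir_tip_lt h'] at h; simp at h
  · rcases eq_or_of_hd_eq h' with rfl | ⟨k, b, rfl⟩
    · simp [dir, off, hd] at h
    · rw [dir_tip_ext] at h; simp at h

theorem dir_eq_lft {q : Bt J} {a : Dy} (hq : q ≠ tip a) : dir (tip a) q = lft ↔ q.hd < a := by
  refine ⟨fun h => ?_, dir_tip_lt⟩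
  by_contra hc
  rcases lt_or_eq_of_le (not_lt.1 hc) with h' | h'
  · rw [dir_tip_gt h'] at h; simp at h
  · rcases eq_or_of_hd_eq h'.symm with rfl | ⟨k, b, rfl⟩
    · exact hq rfl
    · rw [dir_tip_ext] at h; simp at h

theorem lemT {x y : Bt J} (hx : x ≠ tip 0) (hy : y ≠ tip 0) (h : dir (tip 0) x = dir (tip 0) y) :
    ∃ γ ∈ Ga J, (∀ z, (z = tip 0 ∨ dir (tip 0) z ≠ dir (tip 0) y) → γ z = z) ∧ γ x = y := by
  classical
  set σ : Equiv.Perm (Dl J) := Equiv.swap rgt (dir (tip 0) y) with hσ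
  obtain ⟨γ, h1, h2, h3⟩ := lemR (x := sB σ x) (y := sB σ y)
    (by rw [← dir_eq_rgt, dir_sB _ hx, h, hσ, Equiv.swap_apply_right])
    (by rw [← dir_eq_rgt, dir_sB _ hy, hσ, Equiv.swap_apply_right])
  refine ⟨(sB σ)⁻¹ * γ * sB σ, mul_mem (mul_mem (inv_mem (sB_mem _)) h1) (sB_mem _), ?_, ?_⟩
  · intro z hz
    have : (sB σ z).hd ≤ 0 := by
      by_contra hc
      rw [not_le, ← dir_eq_rgt] at hc
      by_cases hz0 : z = tip 0
      · rw [hz0, sB_base, dir_eq_rgt] at hc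
        exact lt_irrefl _ hc
      · rw [dir_sB _ hz0, hσ, Equiv.swap_apply_eq_iff, Equiv.swap_apply_left] at hc
        rcases hz with hz | hz
        · exact hz0 hz
        · exact hz hc
    simp only [Equiv.Perm.mul_apply]
    rw [h2 _ this, perm_ia]
  · simp only [Equiv.Perm.mul_apply]
    rw [h3, perm_ia]

theorem Ga_base (x : Bt J) : ∃ γ ∈ Ga J, γ x = tip 0 := by
  obtain ⟨f, hf, hfx⟩ := Dy.F_trans x.hd Dy.one
  obtain ⟨t, ht, ht0⟩ := Dy.F_trans Dy.one 0
  obtain ⟨γ, h1, _, h3⟩ := to_one _ (fB f x) rfl (by rw [fB_apply, hd_mapHd, hfx]; exact Dy.one_pos)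
  refine ⟨fB t * γ * fB f, mul_mem (mul_mem (fB_mem ht) h1) (fB_mem hf), ?_⟩
  simp only [Equiv.Perm.mul_apply]
  rw [h3, fB_tip, ht0]

theorem Ga_trans (x y : Bt J) : ∃ γ ∈ Ga J, γ x = y := by
  obtain ⟨γ, h1, h2⟩ := Ga_base x
  obtain ⟨γ', h1', h2'⟩ := Ga_base y
  refine ⟨γ'⁻¹ * γ, mul_mem (inv_mem h1') h1, ?_⟩
  rw [Equiv.Perm.mul_apply, h2, ← h2', perm_ia]

theorem Ga_pair (p q : Bt J) (h : p ≠ q) : ∃ γ ∈ Ga J, γ p = tip 0 ∧ γ q = tip Dy.one := by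
  classical
  obtain ⟨γ, h1, h2⟩ := Ga_base p
  have hq : γ q ≠ tip 0 := by rw [← h2]; exact γ.injective.ne h.symm
  set σ : Equiv.Perm (Dl J) := Equiv.swap rgt (dir (tip 0) (γ q)) with hσ
  obtain ⟨γ', h1', h2', h3'⟩ := to_one _ (sB σ (γ q)) rfl
    (by rw [← dir_eq_rgt, dir_sB _ hq, hσ, Equiv.swap_apply_right])
  refine ⟨γ' * sB σ * γ, mul_mem (mul_mem h1' (sB_mem _)) h1, ?_, ?_⟩
  · simp only [Equiv.Perm.mul_apply]
    rw [h2, sB_base, h2' _ le_rfl]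
  · exact h3'

theorem hom2_base {f : Equiv.Perm (Bt J)} (hf : f ∈ (tree J).Aut) (E : Finset (Bt J))
    (hE : ∀ e ∈ E, f e = e) (hm : f (tip 0) = tip 0) (x : Bt J) (hx : x ≠ tip 0)
    (h : ∀ e ∈ E, e ≠ tip 0 → dir (tip 0) e ≠ dir (tip 0) x) :
    ∃ γ ∈ Ga J, (∀ e ∈ E, γ e = e) ∧ γ x = f x := by
  classical
  have hfx : f x ≠ tip 0 := by rw [← hm]; exact f.injective.ne hx
  have h' : ∀ e ∈ E, e ≠ tip 0 → dir (tip 0) e ≠ dir (tip 0) (f x) := by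
    intro e he hne hc
    apply h e he hne
    have := (hf (tip 0) e x hne hx).2
    rw [hm, hE e he] at this
    exact this hc
  set σ : Equiv.Perm (Dl J) := Equiv.swap (dir (tip 0) x) (dir (tip 0) (f x)) with hσ
  have hsx : sB σ x ≠ tip 0 := by
    rw [← sB_base σ]; exact (sB σ).injective.ne hx
  obtain ⟨γ, h1, h2, h3⟩ := lemT hsx hfx (by rw [dir_sB _ hx, hσ, Equiv.swap_apply_left])
  refine ⟨γ * sB σ, mul_mem h1 (sB_mem _), ?_, h3⟩
  intro e he
  rw [Equiv.Perm.mul_apply]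
  by_cases hne : e = tip 0
  · rw [hne, sB_base, h2 _ (Or.inl rfl)]
  · rw [sB_fix (Equiv.swap_apply_of_ne_of_ne (h e he hne) (h' e he hne)), h2 _ (Or.inr (h' e he hne))]

theorem conj_fix {f : Equiv.Perm (Bt J)} (hf : f ∈ (tree J).Aut) (E : Finset (Bt J))
    (hE : ∀ e ∈ E, f e = e) (x : Bt J) (γ : Equiv.Perm (Bt J)) (hγ : γ ∈ Ga J)
    (h : ∀ f' ∈ (tree J).Aut, f' = γ * f * γ⁻¹ → ∀ E' : Finset (Bt J), (∀ e, e ∈ E' ↔ γ⁻¹ e ∈ E) →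
      (∀ e ∈ E', f' e = e) → ∃ δ ∈ Ga J, (∀ e ∈ E', δ e = e) ∧ δ (γ x) = f' (γ x)) :
    ∃ γ ∈ Ga J, (∀ e ∈ E, γ e = e) ∧ γ x = f x := by
  classical
  obtain ⟨δ, h1, h2, h3⟩ := h (γ * f * γ⁻¹) (mul_mem (mul_mem (Ga_le hγ) hf) (inv_mem (Ga_le hγ))) rfl
    (E.image γ) (by
      intro e
      rw [Finset.mem_image]
      constructor
      · rintro ⟨a, ha, rfl⟩; rwa [perm_ia]
      · intro he; exact ⟨_, he, perm_ai _ _⟩) (by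
      intro e he
      obtain ⟨a, ha, rfl⟩ := Finset.mem_image.1 he
      simp only [Equiv.Perm.mul_apply]
      rw [perm_ia, hE a ha])
  refine ⟨γ⁻¹ * δ * γ, mul_mem (mul_mem (inv_mem hγ) h1) hγ, ?_, ?_⟩
  · intro e he
    simp only [Equiv.Perm.mul_apply]
    rw [h2 _ (Finset.mem_image_of_mem _ he), perm_ia]
  · simp only [Equiv.Perm.mul_apply] at h3 ⊢
    rw [h3, perm_ia, perm_ia]

theorem hom2 {f : Equiv.Perm (Bt J)} (hf : f ∈ (tree J).Aut) (E : Finset (Bt J))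
    (hE : ∀ e ∈ E, f e = e) (m : Bt J) (hm : f m = m) (x : Bt J) (hx : x ≠ m)
    (h : ∀ e ∈ E, e ≠ m → dir m e ≠ dir m x) :
    ∃ γ ∈ Ga J, (∀ e ∈ E, γ e = e) ∧ γ x = f x := by
  obtain ⟨γ, h1, h2⟩ := Ga_base m
  apply conj_fix hf E hE x γ h1
  intro f' hf' hff E' hE' hfix
  apply hom2_base hf' E' hfix
  · rw [hff, ← h2]
    simp only [Equiv.Perm.mul_apply]
    rw [perm_ia, hm]
  · rw [← h2]; exact γ.injective.ne hx
  · intro e he hne hc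
    have he' := (hE' e).1 he
    have hne' : γ⁻¹ e ≠ m := by
      rintro hh; rw [← hh, perm_ai] at h2; exact hne h2
    apply h _ he' hne'
    apply (Ga_le h1 m (γ⁻¹ e) x hne' hx).2
    rw [h2, perm_ai]; exact hc

theorem bet_tip {x : Bt J} {a b : Dy} (h : dir x (tip a) ≠ dir x (tip b)) : ∃ c, x = tip c := by
  cases x with
  | tip c => exact ⟨c, rfl⟩
  | ext c j b => simp [dir_ext_tip] at h

theorem bet_tip01 {x : Bt J} (h : (tree J).Bet x (tip 0) (tip Dy.one)) :
    ∃ c, x = tip c ∧ 0 < c ∧ c < Dy.one := by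
  obtain ⟨h1, h2, h3⟩ := h
  rw [tree_dir, tree_dir] at h3
  obtain ⟨c, rfl⟩ := bet_tip h3
  refine ⟨c, rfl, ?_, ?_⟩
  · by_contra hc
    rcases lt_or_eq_of_le (not_lt.1 hc) with hc | hc
    · apply h3
      rw [dir_tip_gt (show c < (tip 0 : Bt J).hd from hc),
        dir_tip_gt (show c < (tip Dy.one : Bt J).hd from hc.trans Dy.one_pos)]
    · exact h1 (by rw [hc])
  · by_contra hc
    rcases lt_or_eq_of_le (not_lt.1 hc) with hc | hc
    · apply h3
      rw [dir_tip_lt (show (tip 0 : Bt J).hd < c from Dy.one_pos.trans hc),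
        dir_tip_lt (show (tip Dy.one : Bt J).hd < c from hc)]
    · exact h2 (by rw [hc])

theorem hom1_base {f : Equiv.Perm (Bt J)} (hf : f ∈ (tree J).Aut) (E : Finset (Bt J))
    (hE : ∀ e ∈ E, f e = e) (h0 : f (tip 0) = tip 0) (h1 : f (tip Dy.one) = tip Dy.one)
    (x : Bt J) (h : (tree J).Bet x (tip 0) (tip Dy.one)) :
    ∃ γ ∈ Ga J, (∀ e ∈ E, γ e = e) ∧ γ x = f x := by
  classical
  have h' : (tree J).Bet (f x) (tip 0) (tip Dy.one) := by
    obtain ⟨g1, g2, g3⟩ := h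
    refine ⟨?_, ?_, ?_⟩
    · rw [← h0]; exact f.injective.ne g1
    · rw [← h1]; exact f.injective.ne g2
    · have := (hf x _ _ g1.symm g2.symm).not.1 g3
      rwa [h0, h1] at this
  obtain ⟨c, rfl, hc0, hc1⟩ := bet_tip01 h
  obtain ⟨c', hc', hc0', hc1'⟩ := bet_tip01 h'
  by_cases hcc : c = c'
  · exact ⟨1, one_mem _, fun _ _ => rfl, by rw [hc', hcc]; rfl⟩
  have hne : ∀ e ∈ E, e ≠ tip c := by
    rintro e he rfl
    rw [hE _ he] at hc'
    injection hc' with hc'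
    exact hcc hc'
  have hne' : ∀ e ∈ E, e ≠ tip c' := by
    intro e he hh
    apply hne e he
    apply f.injective
    rw [hE e he, hc', hh]
  have hlt : ∀ e ∈ E, (e.hd < c ↔ e.hd < c') := by
    intro e he
    have := hf (tip c) e (tip 0) (hne e he) h.1.symm
    rw [hE e he, h0, hc'] at this
    simp only [tree_dir] at this
    rwa [dir_tip_lt (show (tip 0 : Bt J).hd < c from hc0), dir_tip_lt (show (tip 0 : Bt J).hd < c' from hc0'),
      dir_eq_lft (hne e he), dir_eq_lft (hne' e he)] at this
  have hgt : ∀ e ∈ E, (c < e.hd ↔ c' < e.hd) := by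
    intro e he
    have := hf (tip c) e (tip Dy.one) (hne e he) h.2.1.symm
    rw [hE e he, h1, hc'] at this
    simp only [tree_dir] at this
    rwa [dir_tip_gt (show c < (tip Dy.one : Bt J).hd from hc1), dir_tip_gt (show c' < (tip Dy.one : Bt J).hd from hc1'),
      dir_eq_rgt, dir_eq_rgt] at this
  have hnc : ∀ e ∈ E, e.hd ≠ c := by
    intro e he hh
    have a1 := hlt e he
    have a2 := hgt e he
    rw [hh] at a1 a2
    rcases lt_trichotomy c c' with hl | hl | hl
    · exact lt_irrefl _ (a1.2 hl)
    · exact hcc hl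
    · exact lt_irrefl _ (a2.2 hl)
  obtain ⟨φ, hφ, hφE⟩ := Dy.F_ext (insert c (E.image hd)) (Function.update id c c') (by
    intro a ha b hb hab
    simp only [Finset.coe_insert, Finset.coe_image, Set.mem_insert_iff, Set.mem_image] at ha hb
    rcases ha with rfl | ⟨e, he, rfl⟩
    · rcases hb with rfl | ⟨e, he, rfl⟩
      · exact absurd hab (lt_irrefl _)
      · rw [Function.update_self, Function.update_of_ne (hnc e he)]
        exact (hgt e he).1 hab
    · rw [Function.update_of_ne (hnc e he)]
      rcases hb with rfl | ⟨e', he', rfl⟩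
      · rw [Function.update_self]
        exact (hlt e he).1 hab
      · rw [Function.update_of_ne (hnc e' he')]
        exact hab)
  refine ⟨fB φ, fB_mem hφ, ?_, ?_⟩
  · intro e he
    have : φ e.hd = e.hd := by
      rw [hφE _ (Finset.mem_insert_of_mem (Finset.mem_image_of_mem _ he)),
        Function.update_of_ne (hnc e he)]; rfl
    cases e with
    | tip a => rw [fB_tip]; exact congrArg tip this
    | ext a j b => rw [fB_ext]; exact congrArg (fun a => ext a j b) this
  · rw [fB_tip, hφE _ (Finset.mem_insert_self _ _), Function.update_self, hc']

theorem hom1 {f : Equiv.Perm (Bt J)} (hf : f ∈ (tree J).Aut) (E : Finset (Bt J))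
    (hE : ∀ e ∈ E, f e = e) (x e e' : Bt J) (he : e ∈ E) (he' : e' ∈ E) (h : (tree J).Bet x e e') :
    ∃ γ ∈ Ga J, (∀ e ∈ E, γ e = e) ∧ γ x = f x := by
  have hne : e ≠ e' := by rintro rfl; exact h.2.2 rfl
  obtain ⟨γ, h1, h2, h3⟩ := Ga_pair e e' hne
  apply conj_fix hf E hE x γ h1
  intro f' hf' hff E' hE' hfix
  apply hom1_base hf' E' hfix
  · apply hfix; rwa [hE', ← h2, perm_ia]
  · apply hfix; rwa [hE', ← h3, perm_ia]
  · rw [← h2, ← h3]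
    exact ⟨γ.injective.ne h.1, γ.injective.ne h.2.1,
      (Ga_le h1 x _ _ h.1.symm h.2.1.symm).not.1 h.2.2⟩

theorem hom {f : Equiv.Perm (Bt J)} (hf : f ∈ (tree J).Aut) (E : Finset (Bt J))
    (hE : ∀ e ∈ E, f e = e) (x : Bt J) :
    ∃ γ ∈ Ga J, (∀ e ∈ E, γ e = e) ∧ γ x = f x := by
  rcases E.eq_empty_or_nonempty with rfl | hne
  · obtain ⟨γ, h1, h2⟩ := Ga_trans x (f x)
    exact ⟨γ, h1, by simp, h2⟩
  obtain ⟨m, hm, hmx⟩ := (tree J).gate x E hne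
  have key : ∃ γ ∈ Ga J, (∀ e ∈ E, γ e = e) ∧ γ m = f m := by
    rcases hm with hm | ⟨e, he, e', he', hb⟩
    · exact ⟨1, one_mem _, fun _ _ => rfl, (hE m hm).symm⟩
    · exact hom1 hf E hE m e e' he he' hb
  rcases hmx with rfl | hmx
  · exact key
  by_cases hxm : x = m
  · rw [hxm]; exact key
  obtain ⟨γ, h1, h2, h3⟩ := key
  obtain ⟨δ, g1, g2, g3⟩ := hom2 (f := γ⁻¹ * f) (mul_mem (inv_mem (Ga_le h1)) hf) E (by
    intro e he
    rw [Equiv.Perm.mul_apply, hE e he]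
    conv_lhs => rw [← h2 e he, perm_ia]) m (by
    rw [Equiv.Perm.mul_apply, ← h3, perm_ia]) x hxm hmx
  refine ⟨γ * δ, mul_mem h1 g1, ?_, ?_⟩
  · intro e he
    rw [Equiv.Perm.mul_apply, g2 e he, h2 e he]
  · rw [Equiv.Perm.mul_apply, g3, Equiv.Perm.mul_apply, perm_ai]

theorem Ga_hom (f : Equiv.Perm (Bt J)) (hf : f ∈ (tree J).Aut) (E : Finset (Bt J)) :
    ∃ γ ∈ Ga J, ∀ e ∈ E, γ e = f e := by
  classical
  induction E using Finset.induction_on with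
  | empty => exact ⟨1, one_mem _, by simp⟩
  | insert x E _ ih =>
    obtain ⟨γ, h1, h2⟩ := ih
    obtain ⟨δ, g1, g2, g3⟩ := hom (f := γ⁻¹ * f) (mul_mem (inv_mem (Ga_le h1)) hf) E (by
      intro e he
      rw [Equiv.Perm.mul_apply, ← h2 e he, perm_ia]) x
    refine ⟨γ * δ, mul_mem h1 g1, ?_⟩
    intro e he
    rcases Finset.mem_insert.1 he with rfl | he
    · rw [Equiv.Perm.mul_apply, g3, Equiv.Perm.mul_apply, perm_ai]
    · rw [Equiv.Perm.mul_apply, g2 e he, h2 e he]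

end Bt

namespace DTree

variable {B Δ : Type} (T : DTree B Δ)

/-- Half-spaces in the set of branch points. -/
def C (p : B) (d : Δ) : Set B := {q | q ≠ p ∧ T.dir p q = d}

theorem mem_C {p q : B} {d : Δ} : q ∈ T.C p d ↔ q ≠ p ∧ T.dir p q = d := Iff.rfl

theorem not_mem_C (p : B) (d : Δ) : p ∉ T.C p d := fun h => h.1 rfl

theorem C_nonempty (p : B) (d : Δ) : ∃ x, x ∈ T.C p d := T.surj p d

theorem C_disj {p q : B} {d e : Δ} (hpq : p ≠ q) (h1 : T.dir p q ≠ d) (h2 : T.dir q p ≠ e) {x : B}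
    (hx : x ∈ T.C p d) : x ∉ T.C q e := by
  intro hx'
  apply h2
  rw [← hx'.2]
  exact (T.sepd (m := p) (p := x) (q := q) hpq hx.1.symm (by rw [hx.2]; exact h1.symm)).symm

theorem C_sub {p q : B} {d e : Δ} (hpq : p ≠ q) (h1 : T.dir p q = d) (h2 : T.dir q p ≠ e) {x : B}
    (hx : x ∈ T.C q e) : x ∈ T.C p d := by
  have hxp : x ≠ p := by rintro rfl; exact h2 hx.2
  refine ⟨hxp, ?_⟩
  rw [← h1]
  exact T.sepd (m := q) (p := x) (q := p) hpq.symm hx.1.symm (by rw [hx.2]; exact h2.symm)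

theorem C_cov {p q : B} {d e : Δ} (hpq : p ≠ q) (h1 : T.dir p q = d) (h2 : T.dir q p = e) {x : B}
    (hx : x ∉ T.C p d) : x ∈ T.C q e := by
  by_cases hxp : x = p
  · rw [hxp]; exact ⟨hpq, h2⟩
  have hxq : x ≠ q := by rintro rfl; exact hx ⟨hxp, h1⟩
  refine ⟨hxq, ?_⟩
  rcases T.tri x p q hpq hxp hxq with h | h
  · exact absurd ⟨hxp, h.trans h1⟩ hx
  · exact h.trans h2

theorem mem_C_map {f : Equiv.Perm B} (hf : f ∈ T.Aut) {p x : B} {d : Δ} :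
    f x ∈ T.C (f p) (T.lam f p d) ↔ x ∈ T.C p d := by
  rw [mem_C, mem_C, f.injective.ne_iff]
  refine and_congr_right fun h => ?_
  rw [T.lam_spec hf h, (T.lam_inj hf p).eq_iff]

theorem image_C {f : Equiv.Perm B} (hf : f ∈ T.Aut) (p : B) (d : Δ) :
    f '' T.C p d = T.C (f p) (T.lam f p d) := by
  ext x
  constructor
  · rintro ⟨y, hy, rfl⟩
    exact (T.mem_C_map hf).2 hy
  · intro hx
    refine ⟨f⁻¹ x, ?_, perm_ai _ _⟩
    rw [← T.mem_C_map hf, perm_ai]; exact hx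

theorem C_inj {p q : B} {d e : Δ} (h : T.C p d = T.C q e) : p = q := by
  by_contra hpq
  by_cases h1 : T.dir p q = d
  · have : q ∈ T.C p d := ⟨Ne.symm hpq, h1⟩
    rw [h] at this
    exact T.not_mem_C _ _ this
  · by_cases h2 : T.dir q p = e
    · have : p ∈ T.C q e := ⟨hpq, h2⟩
      rw [← h] at this
      exact T.not_mem_C _ _ this
    · obtain ⟨x, hx⟩ := T.C_nonempty p d
      exact T.C_disj hpq h1 h2 hx (h ▸ hx)

theorem tricho {f : Equiv.Perm B} (hf : f ∈ T.Aut) (p : B) (d : Δ) :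
    (∀ x ∈ T.C p d, f x ∉ T.C p d) ∨ (∀ x ∈ T.C p d, f x ∈ T.C p d) ∨
    (∀ x ∈ T.C p d, f⁻¹ x ∈ T.C p d) ∨ (∀ x, x ∉ T.C p d → f⁻¹ x ∈ T.C p d) := by
  have hinv : ∀ x, x ∈ T.C (f p) (T.lam f p d) → f⁻¹ x ∈ T.C p d := by
    intro x hx
    rw [← T.mem_C_map hf, perm_ai]; exact hx
  by_cases hpq : f p = p
  · by_cases hd : T.lam f p d = d
    · right; left
      intro x hx
      have := (T.mem_C_map hf).2 hx
      rwa [hpq, hd] at this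
    · left
      intro x hx hx'
      have := (T.mem_C_map hf).2 hx
      rw [hpq] at this
      exact hd (this.2.symm.trans hx'.2)
  · by_cases h1 : T.dir p (f p) = d
    · by_cases h2 : T.dir (f p) p = T.lam f p d
      · right; right; right
        intro x hx
        exact hinv _ (T.C_cov (Ne.symm hpq) h1 h2 hx)
      · right; left
        intro x hx
        exact T.C_sub (Ne.symm hpq) h1 h2 ((T.mem_C_map hf).2 hx)
    · by_cases h2 : T.dir (f p) p = T.lam f p d
      · right; right; left
        intro x hx
        exact hinv _ (T.C_sub hpq h2 h1 hx)
      · left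
        intro x hx hx'
        exact T.C_disj (Ne.symm hpq) h1 h2 hx' ((T.mem_C_map hf).2 hx)

theorem pow_maps {f : Equiv.Perm B} {I : Set B} (h : ∀ x ∈ I, f x ∈ I) (n : ℕ) :
    ∀ x ∈ I, (f ^ n) x ∈ I := by
  induction n with
  | zero => intro x hx; exact hx
  | succ n ih => intro x hx; rw [pow_succ, Equiv.Perm.mul_apply]; exact ih _ (h x hx)

theorem inv_disj {f : Equiv.Perm B} {I : Set B} (h : ∀ x ∈ I, f x ∉ I) : ∀ x ∈ I, f⁻¹ x ∉ I := by
  intro x hx hc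
  have := h _ hc
  rw [perm_ai] at this
  exact this hx

theorem wander {g : Equiv.Perm B} (hg : g ∈ T.Aut) (p : B) (d : Δ) (M : ℕ) (hM : 0 < M)
    (hW : ∀ i : ℤ, i ≠ 0 → ∀ x ∈ T.C p d, (g ^ ((M : ℤ) * i)) x ∉ T.C p d) (j : ℤ) (hj : j ≠ 0) :
    ∀ x ∈ T.C p d, (g ^ j) x ∉ T.C p d := by
  obtain ⟨x0, hx0⟩ := T.C_nonempty p d
  have e1 : ∀ i : ℤ, (g ^ i) ^ M = g ^ ((M : ℤ) * i) := by
    intro i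
    rw [← zpow_natCast, ← zpow_mul, mul_comm]
  rcases T.tricho (zpow_mem hg j) p d with h | h | h | h
  · exact h
  · exfalso
    have := pow_maps h M x0 hx0
    rw [e1] at this
    exact hW j hj x0 hx0 this
  · exfalso
    have := pow_maps h M x0 hx0
    rw [← zpow_neg, e1] at this
    exact hW (-j) (neg_ne_zero.2 hj) x0 hx0 this
  · by_cases h1 : M = 1
    · subst h1
      have := hW j hj
      simpa using this
    · exfalso
      have h2 : ∀ x ∈ T.C p d, (g ^ (((M : ℤ) - 1) * j)) x ∈ T.C p d := by
        intro x hx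
        have := h _ (hW j hj x hx)
        rw [← zpow_neg, ← Equiv.Perm.mul_apply, ← zpow_add] at this
        convert this using 3
        ring
      have := pow_maps h2 M x0 hx0
      rw [e1] at this
      refine hW _ (mul_ne_zero ?_ hj) x0 hx0 this
      omega

theorem strictCase (hΔ : ∀ a b : Δ, ∃ c, c ≠ a ∧ c ≠ b) {g : Equiv.Perm B} (hg : g ∈ T.Aut)
    (p : B) (d : Δ) (k : ℤ) (h1 : ∀ x ∈ T.C p d, (g ^ k) x ∈ T.C p d)
    (h2 : ∃ x ∈ T.C p d, (g ^ k)⁻¹ x ∉ T.C p d) :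
    ∃ q e, ∀ j : ℤ, j ≠ 0 → ∀ x ∈ T.C q e, (g ^ j) x ∉ T.C q e := by
  have hk : k ≠ 0 := by
    rintro rfl
    obtain ⟨x, hx, hx'⟩ := h2
    exact hx' (by simpa using hx)
  set h := g ^ k with hh
  have hA : h ∈ T.Aut := zpow_mem hg k
  obtain ⟨x1, hx1, hx1'⟩ := h2
  obtain ⟨x0, hx0⟩ := T.C_nonempty p d
  have hx1'' : x1 ∉ T.C (h p) (T.lam h p d) := by
    intro hc
    apply hx1'
    rw [← T.mem_C_map hA, perm_ai]; exact hc
  have hpp : p ≠ h p := by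
    intro hp
    have a1 := (T.mem_C_map hA).2 hx0
    have a2 := h1 _ hx0
    have : T.lam h p d = d := by
      rw [← a1.2, ← a2.2, ← hp]
    rw [← hp, this] at hx1''
    exact hx1'' hx1
  by_cases c1 : T.dir p (h p) = d
  · by_cases c2 : T.dir (h p) p = T.lam h p d
    · exfalso
      have : p ∈ T.C (h p) (T.lam h p d) := ⟨hpp, c2⟩
      rw [← T.image_C hA] at this
      obtain ⟨y, hy, hyp⟩ := this
      have := h1 y hy
      rw [hyp] at this
      exact T.not_mem_C _ _ this
    · obtain ⟨e, he1, he2⟩ := hΔ (T.lam h p d) (T.dir (h p) p)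
      have hsub : ∀ x ∈ T.C (h p) e, x ∈ T.C p d := fun x hx => T.C_sub hpp c1 he2.symm hx
      have hpos : ∀ n : ℕ, ∀ x ∈ T.C (h p) e, (h ^ (n + 1)) x ∉ T.C (h p) e := by
        intro n x hx hc
        rw [pow_succ', Equiv.Perm.mul_apply] at hc
        have := (T.mem_C_map hA).2 (pow_maps h1 n x (hsub x hx))
        exact he1 (hc.2.symm.trans this.2)
      have hall : ∀ i : ℤ, i ≠ 0 → ∀ x ∈ T.C (h p) e, (h ^ i) x ∉ T.C (h p) e := by
        intro i hi
        obtain ⟨n, hn⟩ : ∃ n : ℕ, i.natAbs = n + 1 := ⟨i.natAbs - 1, by omega⟩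
        rcases Int.natAbs_eq i with hi' | hi'
        · rw [hi', hn, zpow_natCast]; exact hpos n
        · rw [hi', hn, zpow_neg, zpow_natCast]; exact inv_disj (hpos n)
      refine ⟨h p, e, T.wander hg _ _ k.natAbs (by omega) ?_⟩
      intro i hi
      rcases Int.natAbs_eq k with hk' | hk'
      · rw [← hk', zpow_mul]; exact hall i hi
      · have : (k.natAbs : ℤ) * i = k * (-i) := by
          rw [show (k.natAbs : ℤ) = -k by omega]; ring
        rw [this, zpow_mul]; exact hall _ (neg_ne_zero.2 hi)
  · exfalso
    by_cases c2 : T.dir (h p) p = T.lam h p d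
    · exact hx1'' (T.C_sub hpp.symm c2 c1 hx1)
    · exact T.C_disj hpp c1 c2 (h1 _ hx0) ((T.mem_C_map hA).2 hx0)

theorem noStrict [Nonempty B] (hΔ : ∀ a b : Δ, ∃ c, c ≠ a ∧ c ≠ b) {g : Equiv.Perm B} (hg : g ∈ T.Aut)
    (hno : ∀ p d (k : ℤ), (∀ x ∈ T.C p d, (g ^ k) x ∈ T.C p d) →
      ∀ x ∈ T.C p d, (g ^ k)⁻¹ x ∈ T.C p d) :
    ∃ p d, ∀ k : ℤ, (∀ x ∈ T.C p d, (g ^ k) x ∈ T.C p d) ∨ (∀ x ∈ T.C p d, (g ^ k) x ∉ T.C p d) := by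
  obtain ⟨p⟩ := ‹Nonempty B›
  obtain ⟨d', hd', -⟩ := hΔ (T.dir p p) (T.dir p p)
  set d := T.dir p p with hd
  have key : ∀ d, (¬ ∃ k : ℤ, ∀ x, x ∉ T.C p d → (g ^ k)⁻¹ x ∈ T.C p d) → ∀ k : ℤ,
      (∀ x ∈ T.C p d, (g ^ k) x ∈ T.C p d) ∨ (∀ x ∈ T.C p d, (g ^ k) x ∉ T.C p d) := by
    intro d hd k
    rcases T.tricho (zpow_mem hg k) p d with h | h | h | h
    · exact Or.inr h
    · exact Or.inl h
    · left
      have := hno p d (-k) (by simpa [zpow_neg] using h)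
      simpa [zpow_neg] using this
    · exact absurd ⟨k, h⟩ hd
  by_cases c1 : ∃ k : ℤ, ∀ x, x ∉ T.C p d → (g ^ k)⁻¹ x ∈ T.C p d
  · by_cases c2 : ∃ k : ℤ, ∀ x, x ∉ T.C p d' → (g ^ k)⁻¹ x ∈ T.C p d'
    · exfalso
      obtain ⟨k, hk⟩ := c1
      obtain ⟨l, hl⟩ := c2
      have a1 : ∀ x ∈ T.C p d', x ∉ T.C p d := fun x hx hx' => hd' (hx.2.symm.trans hx'.2)
      have a2 : ∀ x ∈ T.C p d, x ∉ T.C p d' := fun x hx hx' => hd' (hx'.2.symm.trans hx.2)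
      have a3 : ∀ y, (g ^ (-l - k)) y = (g ^ l)⁻¹ ((g ^ k)⁻¹ y) := by
        intro y
        rw [← zpow_neg, ← zpow_neg, ← Equiv.Perm.mul_apply, ← zpow_add]; rfl
      have a4 := hno p d' (-l - k) (by
        intro x hx
        rw [a3]
        exact hl _ (a2 _ (hk _ (a1 x hx))))
      have a5 := hl _ (a2 _ (hk p (T.not_mem_C p d)))
      have a6 := a4 _ a5
      rw [← a3, perm_ia] at a6
      exact T.not_mem_C _ _ a6
    · exact ⟨p, d', key d' c2⟩
  · exact ⟨p, d, key d c1⟩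

theorem fix_base {h : Equiv.Perm B} (hA : h ∈ T.Aut) {p : B} {d : Δ} (h1 : ∀ x ∈ T.C p d, h x ∈ T.C p d)
    (h2 : ∀ x ∈ T.C p d, h⁻¹ x ∈ T.C p d) : h p = p := by
  have : T.C (h p) (T.lam h p d) = T.C p d := by
    rw [← T.image_C hA]
    ext x
    constructor
    · rintro ⟨y, hy, rfl⟩; exact h1 y hy
    · intro hx; exact ⟨_, h2 x hx, perm_ai _ _⟩
  exact T.C_inj this

theorem compar {p z w w' : B} (hw : w ≠ p) (hw' : w' ≠ p) (h : w = z ∨ T.dir w p ≠ T.dir w z)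
    (h' : w' = z ∨ T.dir w' p ≠ T.dir w' z) (hne : w ≠ w') :
    T.dir w p ≠ T.dir w w' ∨ T.dir w' p ≠ T.dir w' w := by
  rcases h with rfl | h
  · rcases h' with h' | h'
    · exact absurd h'.symm hne
    · exact Or.inr h'
  · rcases h' with rfl | h'
    · exact Or.inl h
    · by_contra hc
      push Not at hc
      obtain ⟨c1, c2⟩ := hc
      by_cases hz1 : z = w
      · subst hz1; exact h' c2
      by_cases hz2 : z = w'
      · subst hz2; exact h c1
      rcases T.tri z w w' hne hz1 hz2 with g | g
      · exact h (c1.trans g.symm)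
      · exact h' (c2.trans g.symm)

theorem line_fix {h : Equiv.Perm B} (hA : h ∈ T.Aut) {p : B} (hp : h p = p)
    (hno : ∀ q e, (∀ x ∈ T.C q e, h x ∈ T.C q e) ↔ (∀ x ∈ T.C q e, h⁻¹ x ∈ T.C q e))
    {z w : B} (hw : w ≠ p) (hwz : w = z ∨ T.dir w p ≠ T.dir w z)
    (hwz' : h w = z ∨ T.dir (h w) p ≠ T.dir (h w) z) : h w = w := by
  by_contra hne
  have hw' : h w ≠ p := by rw [← hp]; exact h.injective.ne hw
  have hmap : ∀ x, h x ∈ T.C (h w) (T.dir (h w) p) ↔ x ∈ T.C w (T.dir w p) := by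
    intro x
    have := T.mem_C_map hA (p := w) (x := x) (d := T.dir w p)
    rwa [← T.lam_spec hA hw.symm, hp] at this
  have hmap' : ∀ x, x ∈ T.C (h w) (T.dir (h w) p) ↔ h⁻¹ x ∈ T.C w (T.dir w p) := by
    intro x
    rw [← hmap, perm_ai]
  rcases T.compar hw hw' hwz hwz' (Ne.symm hne) with c | c
  · have c2 : T.dir (h w) p = T.dir (h w) w := T.sepd (Ne.symm hne) hw c
    have hs : ∀ x ∈ T.C w (T.dir w p), x ∈ T.C (h w) (T.dir (h w) p) := fun x hx =>
      T.C_sub hne c2.symm c.symm hx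
    have := (hno (h w) (T.dir (h w) p)).2 (by
      intro x hx
      exact hs _ ((hmap' x).1 hx)) w ⟨Ne.symm hne, c2.symm⟩
    exact T.not_mem_C _ _ this
  · have c2 : T.dir w p = T.dir w (h w) := T.sepd hne hw' c
    have hs : ∀ x ∈ T.C (h w) (T.dir (h w) p), x ∈ T.C w (T.dir w p) := fun x hx =>
      T.C_sub (Ne.symm hne) c2.symm c.symm hx
    have := (hno w (T.dir w p)).1 (by
      intro x hx
      exact hs _ ((hmap x).2 hx)) (h w) ⟨hne, c2.symm⟩
    rw [perm_ia] at this
    exact T.not_mem_C _ _ this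

theorem bet_avoid (S : Set B) (hS : S.Finite) (p w : B) (h : p ≠ w) : ∃ y, T.Bet y p w ∧ y ∉ S := by
  induction S, hS using Set.Finite.induction_on generalizing w with
  | empty =>
    obtain ⟨r, h1, h2, h3⟩ := T.dense p w h
    exact ⟨r, ⟨h1, h2, h3⟩, by simp⟩
  | @insert s S _ _ ih =>
    obtain ⟨y, hy, hyS⟩ := ih w h
    by_cases hys : y = s
    · obtain ⟨y', hy', hyS'⟩ := ih y hy.1.symm
      refine ⟨y', ?_, ?_⟩
      · have b1 : T.dir y p = T.dir y y' := T.sepd hy'.2.1 hy'.1 hy'.2.2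
        have hne : y' ≠ w := by
          rintro rfl
          exact hy.2.2 b1
        have b2 : T.dir y' w = T.dir y' y :=
          T.sepd (m := y) (p := w) (q := y') hy'.2.1.symm hy.2.1 (by rw [← b1]; exact hy.2.2.symm)
        exact ⟨hy'.1, hne, by rw [b2]; exact hy'.2.2⟩
      · rintro (hh | hh)
        · exact hy'.2.1 (hh.trans hys.symm)
        · exact hyS' hh
    · exact ⟨y, hy, by rintro (hh | hh); exacts [hys hh, hyS hh]⟩

end DTree

namespace Bt

variable {J : Type}

theorem three_dirs [Nonempty J] (a b : Dl J) : ∃ c, c ≠ a ∧ c ≠ b := by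
  obtain ⟨j⟩ := ‹Nonempty J›
  by_contra hc
  push Not at hc
  have h1 := hc lft
  have h2 := hc rgt
  have h3 := hc (Sum.inr j)
  by_cases c1 : (lft : Dl J) = a
  · subst c1
    have h2 := h2 (by simp)
    have h3 := h3 (by simp)
    rw [← h2] at h3
    simp at h3
  · have h1 := h1 c1
    subst h1
    by_cases c2 : (rgt : Dl J) = a
    · subst c2
      have h3 := h3 (by simp)
      simp at h3
    · have := h2 c2
      simp at this

theorem dyn [Nonempty J] {g : Equiv.Perm (Bt J)} (hg : g ∈ Ga J) :
    ∃ p d, ∀ k : ℤ, (∀ x ∈ (tree J).C p d, (g ^ k) x = x) ∨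
      (∀ x ∈ (tree J).C p d, (g ^ k) x ∉ (tree J).C p d) := by
  set T := tree J with hT
  have hA : g ∈ T.Aut := Ga_le hg
  by_cases hs : ∃ p d, ∃ k : ℤ, (∀ x ∈ T.C p d, (g ^ k) x ∈ T.C p d) ∧
      ∃ x ∈ T.C p d, (g ^ k)⁻¹ x ∉ T.C p d
  · obtain ⟨p, d, k, h1, h2⟩ := hs
    obtain ⟨q, e, h⟩ := T.strictCase three_dirs hA p d k h1 h2
    refine ⟨q, e, fun j => ?_⟩
    by_cases hj : j = 0
    · left; subst hj; intro x _; rfl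
    · exact Or.inr (h j hj)
  · have hno : ∀ p d (k : ℤ), (∀ x ∈ T.C p d, (g ^ k) x ∈ T.C p d) →
        ∀ x ∈ T.C p d, (g ^ k)⁻¹ x ∈ T.C p d := by
      intro p d k h x hx
      by_contra hc
      exact hs ⟨p, d, k, h, x, hx, hc⟩
    have hno2 : ∀ p d (k : ℤ), (∀ x ∈ T.C p d, (g ^ k) x ∈ T.C p d) ↔
        (∀ x ∈ T.C p d, (g ^ k)⁻¹ x ∈ T.C p d) := by
      intro p d k
      refine ⟨hno p d k, fun h => ?_⟩
      have := hno p d (-k) (by simpa [zpow_neg] using h)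
      simpa [zpow_neg] using this
    obtain ⟨p, d, hpd⟩ := T.noStrict three_dirs hA hno
    let St : AddSubgroup ℤ :=
      { carrier := {k | ∀ x ∈ T.C p d, (g ^ k) x ∈ T.C p d}
        zero_mem' := fun x hx => hx
        add_mem' := by
          intro a b ha hb x hx
          rw [zpow_add, Equiv.Perm.mul_apply]
          exact ha _ (hb _ hx)
        neg_mem' := by
          intro a ha x hx
          rw [zpow_neg]
          exact hno p d a ha x hx }
    obtain ⟨M, hM⟩ := Int.subgroup_cyclic St
    have hMst : ∀ x ∈ T.C p d, (g ^ M) x ∈ T.C p d := by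
      have : M ∈ St := by rw [hM]; exact AddSubgroup.subset_closure rfl
      exact this
    set h := g ^ M with hh
    have hhG : h ∈ Ga J := zpow_mem hg M
    have hhA : h ∈ T.Aut := Ga_le hhG
    have hp : h p = p := T.fix_base hhA hMst (hno p d M hMst)
    have hnoh := fun q e => hno2 q e M
    rw [← hh] at hnoh
    obtain ⟨x, hx⟩ := T.C_nonempty p d
    have hhx := hMst x hx
    obtain ⟨w, w1, w2, w3⟩ := T.med p x (h x)
    have hwp : w ≠ p := by
      rintro rfl
      rcases w2 with c | c | c
      · exact hx.1 c.symm
      · exact hhx.1 c.symm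
      · exact c (hx.2.trans hhx.2.symm)
    have hww : h w = w := by
      refine T.line_fix hhA hp hnoh (z := h x) hwp ?_ ?_
      · rcases w3 with c | c | c
        · exact absurd c hwp
        · exact Or.inl c
        · exact Or.inr c
      · rcases w1 with c | c | c
        · exact absurd c hwp
        · exact Or.inl (by rw [c])
        · by_cases hwx : w = x
          · exact Or.inl (by rw [hwx])
          right
          have := (hhA w p x hwp.symm (Ne.symm hwx)).not.1 c
          rwa [hp] at this
    have hpw : T.dir p w = d := by
      rw [← hx.2]
      rcases w1 with c | c | c
      · exact absurd c hwp
      · rw [c]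
      · by_cases hwx : w = x
        · rw [hwx]
        exact (T.sepd hwp hwx c.symm).symm
    obtain ⟨y, hy, hyS⟩ := T.bet_avoid _ ((bad_finite hhG).union (finite_off p)) p w hwp.symm
    have hyb : y ∉ bad h := fun c => hyS (Or.inl c)
    have hyo : ¬ ∃ j, dir y p = Sum.inr j := fun c => hyS (Or.inr c)
    have hyy : h y = y := by
      refine T.line_fix hhA hp hnoh (z := w) hy.1 (Or.inr hy.2.2) (Or.inr ?_)
      have := (hhA y p w hy.1.symm hy.2.1.symm).not.1 hy.2.2
      rwa [hp, hww] at this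
    have hpy : T.dir p y = d := by
      rw [← hpw]
      exact (T.sepd hy.1 hy.2.1 hy.2.2.symm).symm
    obtain ⟨j⟩ := ‹Nonempty J›
    have hsub : ∀ x ∈ T.C y (Sum.inr j), x ∈ T.C p d := fun x hx =>
      T.C_sub hy.1.symm hpy (fun c => hyo ⟨j, c⟩) hx
    have hfix : ∀ x ∈ T.C y (Sum.inr j), h x = x := by
      intro x hx
      obtain ⟨b, rfl⟩ := eq_plus y x j hx.2
      by_contra hc
      exact hyb ⟨j, b, by rwa [hyy]⟩
    refine ⟨y, Sum.inr j, fun k => ?_⟩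
    rcases hpd k with c | c
    · left
      have hk : k ∈ St := c
      rw [hM, AddSubgroup.mem_closure_singleton] at hk
      obtain ⟨n, rfl⟩ := hk
      intro x hx
      rw [smul_eq_mul, mul_comm, zpow_mul, ← hh]
      exact Function.IsFixedPt.perm_zpow (hfix x hx) n
    · right
      intro x hx hc
      exact c x (hsub x hx) (hsub _ hc)

end Bt


section PingPong

variable {B ι : Type*}

/-- Reachable points in the ping-pong argument. -/
inductive Reach (U : ι → Set B) (ω : B) (g : ι → Equiv.Perm B) : Option ι → B → Prop
  | base : Reach U ω g none ω
  | step (i : ι) (k : ℤ) (y : B) (o : Option ι) (h : Reach U ω g o y) (ho : o ≠ some i) (hy : y ∉ U i)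
      (hk : (g i ^ k) y ∈ U i) : Reach U ω g (some i) ((g i ^ k) y)

theorem Reach.not_mem {U : ι → Set B} {ω : B} {g : ι → Equiv.Perm B}
    (hU : ∀ i j, i ≠ j → ∀ x ∈ U i, x ∉ U j) (hω : ∀ i, ω ∉ U i) {o : Option ι} {y : B}
    (h : Reach U ω g o y) {i : ι} (hi : o ≠ some i) : y ∉ U i := by
  cases h with
  | base => exact hω i
  | step i' k y o h ho hy hk =>
    exact hU i' i (fun c => hi (by rw [c])) _ hk

theorem Reach.act {U : ι → Set B} {ω : B} {g : ι → Equiv.Perm B}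
    (hU : ∀ i j, i ≠ j → ∀ x ∈ U i, x ∉ U j) (hω : ∀ i, ω ∉ U i)
    (hg : ∀ i (k : ℤ), (∀ x, x ∉ U i → (g i ^ k) x = x) ∨ (∀ x, x ∉ U i → (g i ^ k) x ∈ U i))
    {o : Option ι} {y : B} (h : Reach U ω g o y) (i : ι) (l : ℤ) :
    ∃ o', Reach U ω g o' ((g i ^ l) y) := by
  have key : ∀ (l : ℤ) (o : Option ι) (y : B), Reach U ω g o y → o ≠ some i →
      ∃ o', Reach U ω g o' ((g i ^ l) y) := by
    intro l o y h ho
    have hy := h.not_mem hU hω ho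
    rcases hg i l with c | c
    · rw [c y hy]; exact ⟨o, h⟩
    · exact ⟨_, Reach.step i l y o h ho hy (c y hy)⟩
  by_cases ho : o = some i
  · subst ho
    cases h with
    | step i' k y o h ho hy hk =>
      rw [← Equiv.Perm.mul_apply, ← zpow_add]
      exact key _ _ _ h ho
  · exact key _ _ _ h ho

theorem Reach.closure {U : ι → Set B} {ω : B} {g : ι → Equiv.Perm B}
    (hU : ∀ i j, i ≠ j → ∀ x ∈ U i, x ∉ U j) (hω : ∀ i, ω ∉ U i)
    (hg : ∀ i (k : ℤ), (∀ x, x ∉ U i → (g i ^ k) x = x) ∨ (∀ x, x ∉ U i → (g i ^ k) x ∈ U i))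
    {h : Equiv.Perm B} (hh : h ∈ Subgroup.closure (Set.range g)) :
    h ω = ω ∨ ∃ i, h ω ∈ U i := by
  have key : ∀ y, (∃ o, Reach U ω g o (h y)) ↔ (∃ o, Reach U ω g o y) := by
    induction hh using Subgroup.closure_induction with
    | mem f hf =>
      obtain ⟨i, rfl⟩ := hf
      intro y
      constructor
      · rintro ⟨o, ho⟩
        have := ho.act hU hω hg i (-1)
        rwa [zpow_neg_one, perm_ia] at this
      · rintro ⟨o, ho⟩
        have := ho.act hU hω hg i 1
        rwa [zpow_one] at this
    | one => intro y; exact Iff.rfl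
    | mul f f' _ _ h1 h2 => intro y; exact (h1 (f' y)).trans (h2 y)
    | inv f _ h1 => intro y; rw [← h1, perm_ai]
  obtain ⟨o, ho⟩ := (key ω).2 ⟨none, Reach.base⟩
  generalize h ω = z at ho
  cases ho with
  | base => exact Or.inl rfl
  | step i k y o h ho hy hk => exact Or.inr ⟨i, hk⟩

end PingPong

section CommTrans

variable {G α : Type*} [Group G]

theorem comm_trans (a : G → α → α) (a1 : ∀ x, a 1 x = x) (am : ∀ g h x, a (g * h) x = a g (a h x))
    (P : α → Prop) (hP : ∀ g x, P x → P (a g x)) (ht : ∀ x y, P x → P y → ∃ g, a g x = y)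
    (S : Set G) (hS : Subgroup.closure S = ⊤)
    (hs : ∀ s ∈ S, ∃ x y γ, P x ∧ P y ∧ a γ y = y ∧ a γ x = a s x) (x y : α) (hx : P x) (hy : P y) :
    ∃ k ∈ commutator G, a k x = y := by
  have hn : ∀ g : G, ∀ k ∈ commutator G, g * k * g⁻¹ ∈ commutator G := fun g k hk =>
    (inferInstance : (commutator G).Normal).conj_mem k hk g
  have hc : ∀ g h : G, g * h * g⁻¹ * h⁻¹ ∈ commutator G := fun g h =>
    Subgroup.commutator_mem_commutator (Subgroup.mem_top g) (Subgroup.mem_top h)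
  have key : ∀ g : G, ∀ x, P x → ∃ k ∈ commutator G, a k x = a g x := by
    intro g
    have hg : g ∈ Subgroup.closure S := by rw [hS]; trivial
    induction hg using Subgroup.closure_induction with
    | mem s hsS =>
      intro x hx
      obtain ⟨x0, y0, γ, hx0, hy0, h1, h2⟩ := hs s hsS
      obtain ⟨h, hh⟩ := ht x0 y0 hx0 hy0
      have hinv : ∀ (g : G) (u v : α), a g u = v → a g⁻¹ v = u := by
        intro g u v huv
        rw [← huv, ← am, inv_mul_cancel, a1]
      have e1 : a (γ * h⁻¹ * γ⁻¹ * h) x0 = a s x0 := by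
        rw [am, hh, am, hinv γ _ _ h1, am, hinv h _ _ hh, h2]
      obtain ⟨t, ht'⟩ := ht x0 x hx0 hx
      refine ⟨s * t * s⁻¹ * t⁻¹ * (t * (γ * h⁻¹ * γ⁻¹ * h) * t⁻¹), ?_, ?_⟩
      · refine mul_mem (hc _ _) (hn _ _ ?_)
        have := hc γ h⁻¹
        rwa [inv_inv] at this
      · rw [am _ (t * (γ * h⁻¹ * γ⁻¹ * h) * t⁻¹), am _ t⁻¹ x, hinv t _ _ ht', am t, e1, ← ht', ← am, ← am, ← am]
        congr 1
        group
    | one => intro x _; exact ⟨1, one_mem _, rfl⟩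
    | mul f g _ _ hf hg =>
      intro x hx
      obtain ⟨k, hk, hkx⟩ := hg x hx
      obtain ⟨l, hl, hlx⟩ := hf x hx
      refine ⟨f * k * f⁻¹ * l, mul_mem (hn _ _ hk) hl, ?_⟩
      rw [am, hlx, am f g, ← hkx, ← am, ← am]
      congr 1
      group
    | inv f _ hf =>
      intro x hx
      obtain ⟨k, hk, hkx⟩ := hf (a f⁻¹ x) (hP _ _ hx)
      refine ⟨k⁻¹, inv_mem hk, ?_⟩
      rw [← am f, mul_inv_cancel, a1] at hkx
      conv_lhs => rw [← hkx, ← am, inv_mul_cancel, a1]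
  obtain ⟨g, hg⟩ := ht x y hx hy
  obtain ⟨k, hk, hkx⟩ := key g x hx
  exact ⟨k, hk, hkx.trans hg⟩

end CommTrans

namespace Bt

variable {J : Type}

theorem fB_C (f : Dy ≃o Dy) (p : Bt J) (d : Dl J) : fB f '' (tree J).C p d = (tree J).C (fB f p) d := by
  rw [(tree J).image_C (fB_Aut f)]
  congr 1
  obtain ⟨q, hq, rfl⟩ := (tree J).surj p d
  rw [← (tree J).lam_spec (fB_Aut f) hq]
  exact dir_fB f p q

theorem sB_C (s : Equiv.Perm (Dl J)) (d : Dl J) :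
    sB s '' (tree J).C (tip 0) d = (tree J).C (tip 0) (s d) := by
  rw [(tree J).image_C (sB_Aut s), sB_base]
  congr 1
  obtain ⟨q, hq, rfl⟩ := (tree J).surj (tip 0) d
  rw [← (tree J).lam_spec (sB_Aut s) hq, sB_base]
  exact dir_sB s hq

theorem Ga_C (p : Bt J) (d : Dl J) : ∃ γ ∈ Ga J, γ '' (tree J).C p d = (tree J).C (tip 0) rgt := by
  obtain ⟨x, hx⟩ := (tree J).C_nonempty p d
  obtain ⟨γ, h1, h2, h3⟩ := Ga_pair p x hx.1.symm
  refine ⟨γ, h1, ?_⟩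
  rw [(tree J).image_C (Ga_le h1), h2]
  congr 1
  rw [← hx.2, ← (tree J).lam_spec (Ga_le h1) hx.1, h2, h3]
  exact dir_tip_gt (show (0 : Dy) < (tip Dy.one : Bt J).hd from Dy.one_pos)

theorem Ga_C_trans (p : Bt J) (d : Dl J) (q : Bt J) (e : Dl J) :
    ∃ γ : Ga J, γ.1 '' (tree J).C p d = (tree J).C q e := by
  obtain ⟨γ, h1, h2⟩ := Ga_C p d
  obtain ⟨δ, h3, h4⟩ := Ga_C q e
  refine ⟨⟨δ⁻¹ * γ, mul_mem (inv_mem h3) h1⟩, ?_⟩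
  change ⇑(δ⁻¹ * γ) '' _ = _
  rw [Equiv.Perm.coe_mul, Set.image_comp, h2, ← h4, ← Set.image_comp, ← Equiv.Perm.coe_mul,
    inv_mul_cancel, Equiv.Perm.coe_one, Set.image_id]

theorem comm_C_trans [Nonempty J] (p : Bt J) (d : Dl J) (q : Bt J) (e : Dl J) :
    ∃ γ ∈ commutator (Ga J), γ.1 '' (tree J).C p d = (tree J).C q e := by
  classical
  refine comm_trans (G := Ga J) (α := Set (Bt J)) (fun γ S => γ.1 '' S) ?_ ?_
    (fun S => ∃ p d, S = (tree J).C p d) ?_ ?_ (((↑) : Ga J → Equiv.Perm (Bt J)) ⁻¹' gensB J)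
    Subgroup.closure_closure_coe_preimage ?_ _ _ ⟨p, d, rfl⟩ ⟨q, e, rfl⟩
  · intro S
    change ⇑(1 : Equiv.Perm (Bt J)) '' S = S
    rw [Equiv.Perm.coe_one, Set.image_id]
  · intro g h S
    change ⇑(g.1 * h.1) '' S = _
    rw [Equiv.Perm.coe_mul, Set.image_comp]
  · rintro g _ ⟨p, d, rfl⟩
    exact ⟨_, _, (tree J).image_C (Ga_le g.2) p d⟩
  · rintro _ _ ⟨p, d, rfl⟩ ⟨q, e, rfl⟩
    exact Ga_C_trans p d q e
  · rintro ⟨_, hs⟩ (⟨f, hf, rfl⟩ | ⟨s, rfl⟩)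
    · obtain ⟨c, hc⟩ := exists_lt (min 0 (f 0))
      obtain ⟨f', hf', h1, h2⟩ := Dy.F_local c 0 (f 0) (hc.trans_le (min_le_left _ _))
        (hc.trans_le (min_le_right _ _))
      refine ⟨(tree J).C (tip 0) rgt, (tree J).C (tip c) rgt, ⟨fB f', fB_mem hf'⟩, ⟨_, _, rfl⟩,
        ⟨_, _, rfl⟩, ?_, ?_⟩
      · change fB f' '' _ = _
        rw [fB_C, fB_tip, h1 c le_rfl]
      · change fB f' '' _ = fB f '' _
        rw [fB_C, fB_C, fB_tip, fB_tip, h2]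
    · obtain ⟨e, he1, he2⟩ := three_dirs (rgt : Dl J) (s rgt)
      refine ⟨(tree J).C (tip 0) rgt, (tree J).C (tip 0) e, ⟨sB (Equiv.swap rgt (s rgt)), sB_mem _⟩,
        ⟨_, _, rfl⟩, ⟨_, _, rfl⟩, ?_, ?_⟩
      · change sB _ '' _ = _
        rw [sB_C, Equiv.swap_apply_of_ne_of_ne he1 he2]
      · change sB _ '' _ = sB s '' _
        rw [sB_C, sB_C, Equiv.swap_apply_left]

theorem nonIG_of {M : Type} [Group M] [Countable M] [Nonempty J] (ρ : M →* Equiv.Perm (Bt J))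
    (h1 : ∀ m, ρ m ∈ Ga J)
    (h2 : ∀ p d q e, ∃ m, ρ m '' (tree J).C p d = (tree J).C q e) : NonIG M := by
  obtain ⟨j0⟩ := id ‹Nonempty J›
  obtain ⟨c, hc⟩ : ∃ c : M → Dy, Function.Injective c := by
    obtain ⟨f, hf⟩ := exists_injective_nat M
    exact ⟨fun m => Infinite.natEmbedding Dy (f m), (Infinite.natEmbedding Dy).injective.comp hf⟩
  have hdyn := fun m => dyn (h1 m)
  choose p d hpd using hdyn
  have hu := fun m => h2 (p m) (d m) (ext (c m) j0 (tip 0)) lft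
  choose u hu using hu
  set U : M → Set (Bt J) := fun m => ((tree J).C (ext (c m) j0 (tip 0)) lft)ᶜ with hUdef
  have hUsub : ∀ m x, x ∈ U m → ∃ b, x = ext (c m) j0 b := by
    intro m x hx
    by_contra hcon
    push Not at hcon
    exact hx ⟨hcon _, dir_ext_out hcon⟩
  have hUdisj : ∀ i j, i ≠ j → ∀ x ∈ U i, x ∉ U j := by
    intro i j hij x hx hx'
    obtain ⟨b, rfl⟩ := hUsub i x hx
    obtain ⟨b', hb'⟩ := hUsub j _ hx'
    injection hb' with h3
    exact hij (hc h3)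
  have hUtip : ∀ i a, tip a ∉ U i := by
    intro i a hx
    obtain ⟨b, hb⟩ := hUsub i _ hx
    cases hb
  set g : M → Equiv.Perm (Bt J) := fun m => ρ (u m * m * (u m)⁻¹) with hg
  have hgU : ∀ i (k : ℤ), (∀ x, x ∉ U i → (g i ^ k) x = x) ∨ (∀ x, x ∉ U i → (g i ^ k) x ∈ U i) := by
    intro i k
    have e1 : ∀ y, (g i ^ k) (ρ (u i) y) = ρ (u i) ((ρ i ^ k) y) := by
      intro y
      have : g i = ρ (u i) * ρ i * (ρ (u i))⁻¹ := by
        rw [hg]; simp only [map_mul, map_inv]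
      rw [this, conj_zpow]
      simp only [Equiv.Perm.mul_apply]
      rw [perm_ia]
    have e2 : ∀ x, x ∉ U i → ∃ y ∈ (tree J).C (p i) (d i), ρ (u i) y = x := by
      intro x hx
      rw [hUdef] at hx
      simp only [Set.mem_compl_iff, not_not] at hx
      rwa [← hu i] at hx
    rcases hpd i k with hk | hk
    · left
      intro x hx
      obtain ⟨y, hy, rfl⟩ := e2 x hx
      rw [e1, hk y hy]
    · right
      intro x hx
      obtain ⟨y, hy, rfl⟩ := e2 x hx
      rw [e1]
      by_contra hcon
      obtain ⟨z, hz, hzy⟩ := e2 _ hcon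
      have := (ρ (u i)).injective hzy
      rw [this] at hz
      exact hk y hy hz
  refine ⟨Subgroup.closure (Set.range fun m => u m * m * (u m)⁻¹), ?_, ?_⟩
  · intro htop
    obtain ⟨t, ht⟩ := h2 (tip 0) rgt (tip Dy.one) rgt
    have ht0 : ρ t (tip 0) = tip Dy.one := by
      rw [(tree J).image_C (Ga_le (h1 t))] at ht
      exact (tree J).C_inj ht
    have htm : t ∈ Subgroup.closure (Set.range fun m => u m * m * (u m)⁻¹) := by rw [htop]; trivial
    have : ρ t ∈ Subgroup.closure (Set.range g) := by
      have := Subgroup.mem_map_of_mem ρ htm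
      rwa [MonoidHom.map_closure, ← Set.range_comp] at this
    rcases Reach.closure hUdisj (fun i => hUtip i 0) hgU this with h | ⟨i, h⟩
    · rw [ht0] at h
      injection h with h
      exact Dy.one_pos.ne' h
    · rw [ht0] at h
      exact hUtip i _ h
  · intro x
    exact ⟨u x, Subgroup.subset_closure ⟨x, rfl⟩⟩

instance Ga_countable [Finite J] : Countable (Ga J) := by
  have : Group.FG (Ga J) := (Group.fg_iff_subgroup_fg _).2 Ga_fg
  obtain ⟨S, hS, f, hf⟩ := Group.fg_iff_exists_freeGroup_hom_surjective.1 this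
  have : Countable (FreeGroup S) := by
    have := hS.to_subtype
    exact (Quot.mk_surjective (r := FreeGroup.Red.Step (α := S))).countable
  exact hf.countable

theorem nonIG_Ga [Finite J] [Nonempty J] : NonIG (Ga J) :=
  nonIG_of (Ga J).subtype (fun m => m.2) Ga_C_trans

theorem nonIG_comm [Finite J] [Nonempty J] : NonIG (commutator (Ga J)) :=
  nonIG_of ((Ga J).subtype.comp (commutator (Ga J)).subtype) (fun m => m.1.2) (by
    intro p d q e
    obtain ⟨γ, h1, h2⟩ := comm_C_trans p d q e
    exact ⟨⟨γ, h1⟩, h2⟩)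

end Bt

theorem statement16 (n : ℕ) (hn : 3 ≤ n) :
    ∃ (X : Type) (_ : TopologicalSpace X) (_ : IsWazewskiDendrite n X)
      (G : Subgroup (X ≃ₜ X)),
      G.FG ∧ Dense (G : Set (X ≃ₜ X)) ∧
      (∃ H : Subgroup G, H ≠ ⊤ ∧ ∀ x : G, ∃ g : G, g * x * g⁻¹ ∈ H) ∧
      ∃ H' : Subgroup ↥(commutator G), H' ≠ ⊤ ∧
        ∀ x : ↥(commutator G), ∃ h : ↥(commutator G), h * x * h⁻¹ ∈ H' := by
  set J : Type := Fin (n - 2) with hJ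
  have : Nonempty J := ⟨⟨0, by omega⟩⟩
  have hcard : Nat.card (Dl J) = n := by
    simp [Dl, hJ]
    omega
  have hW := (Bt.tree J).isWazewski
  rw [hcard] at hW
  set φ := (Bt.tree J).Phi.comp (Subgroup.inclusion (Bt.Ga_le (J := J))) with hφ
  have hinj : Function.Injective φ :=
    (Bt.tree J).Phi_injective.comp (Subgroup.inclusion_injective _)
  have e : Bt.Ga J ≃* φ.range := MonoidHom.ofInjective hinj
  have : Group.FG (Bt.Ga J) := (Group.fg_iff_subgroup_fg _).2 Bt.Ga_fg
  refine ⟨(Bt.tree J).X, inferInstance, hW, φ.range, ?_, ?_, ?_, ?_⟩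
  · exact (Group.fg_iff_subgroup_fg _).1 (Group.fg_range φ)
  · exact (Bt.tree J).dense_of (by rw [hcard]; exact hn) _ Bt.Ga_le Bt.Ga_hom
  · exact NonIG.of_equiv e Bt.nonIG_Ga
  · exact nonIG_commutator_of_equiv e Bt.nonIG_comm
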